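/- In the repulsive-partition model with B > 9, suppose f₀ ∈ C(t,M,η) with sup|f₀| < B₀ and t ≤ 1, and fix x ∈ (0,1). With δ > 0 chosen small enough (as in the companion large-bias lemma), E[ 1_{Ω_{n,x}(u₁)} · Π( S : n_{I_x^S} ≤ s_n(δ) | D_n ) ] = o(1/n) as n → ∞. -/

import Mathlib

open MeasureTheory Filter Set ProbabilityTheory
open scoped ENNReal NNReal Classical BigOperators

noncomputable section

namespace Spatial

/-- the mother Haar wavelet ψ = 1_{(0,1/2]} − 1_{(1/2,1]} -/
def psi (x : ℝ) : ℝ :=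
  if x ∈ Set.Ioc (0 : ℝ) (1 / 2) then 1 else if x ∈ Set.Ioc (1 / 2 : ℝ) 1 then -1 else 0

/-- the Haar wavelet ψ_{lk}(x) = 2^{l/2} ψ(2^l x − k) -/
def haar (l k : ℕ) (x : ℝ) : ℝ := (2 : ℝ) ^ ((l : ℝ) / 2) * psi ((2 : ℝ) ^ l * x - k)

/-- the father wavelet ψ_{−1,0} = 1_{[0,1]} -/
def father (x : ℝ) : ℝ := if x ∈ Set.Icc (0 : ℝ) 1 then 1 else 0

/-- the dyadic interval I_{lk} = (k 2^{−l}, (k+1) 2^{−l}] -/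
def dyadic (l k : ℕ) : Set ℝ := Set.Ioc ((k : ℝ) / 2 ^ l) (((k : ℝ) + 1) / 2 ^ l)

/-- the Haar coefficient β⁰_{lk} = ∫₀¹ f ψ_{lk} -/
def coef (f : ℝ → ℝ) (l k : ℕ) : ℝ := ∫ x in Set.Ioc (0 : ℝ) 1, f x * haar l k x

/-- the father coefficient ⟨f, ψ_{−1,0}⟩ -/
def coefFather (f : ℝ → ℝ) : ℝ := ∫ x in Set.Ioc (0 : ℝ) 1, f x

/-- k_l(x) : the index k with x ∈ I_{lk} (for x ∈ (0,1]) -/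
def kAt (l : ℕ) (x : ℝ) : ℕ := ⌈(2 : ℝ) ^ l * x⌉₊ - 1

/-- f belongs to the local Hölder class C(t,x,M,η) at the point x -/
def HolderAt (f : ℝ → ℝ) (t M η : ℝ) (x : ℝ) : Prop :=
  (∀ y ∈ Set.Icc (0 : ℝ) 1, |f y| ≤ M) ∧
    ∀ m : ℝ, m ≠ 0 → |m| ≤ η → x + m ∈ Set.Icc (0 : ℝ) 1 →
      |f (x + m) - f x| ≤ M * |m| ^ t

/-- the class C(t,M,η) of locally Hölder functions -/
def HolderClass (t M η : ℝ → ℝ) : Set (ℝ → ℝ) :=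
  {f | ∀ x ∈ Set.Icc (0 : ℝ) 1, HolderAt f (t x) (M x) (η x) x}

/-- Assumption A1 on the smoothness functions t, M, η -/
structure A1 (t M η : ℝ → ℝ) (t₁ : ℝ) : Prop where
  ht₁ : 0 < t₁
  t_lb : ∀ x ∈ Set.Icc (0 : ℝ) 1, t₁ ≤ t x
  t_ub : ∀ x ∈ Set.Icc (0 : ℝ) 1, t x ≤ 1
  M_ub : ∃ Mmax > 0, ∀ x ∈ Set.Icc (0 : ℝ) 1, M x ≤ Mmax
  M_lb : ∃ Mmin > 0, ∀ x ∈ Set.Icc (0 : ℝ) 1, Mmin ≤ M x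
  eta_ub : ∃ emax > 0, ∀ x ∈ Set.Icc (0 : ℝ) 1, η x ≤ emax
  eta_lb : ∃ emin > 0, ∀ x ∈ Set.Icc (0 : ℝ) 1, emin ≤ η x

/-- η_{lk} = min_{y ∈ I_{lk}} η(y) -/
def etaLK (η : ℝ → ℝ) (l k : ℕ) : ℝ := sInf (η '' dyadic l k)

/-- M_{lk} = max_{y ∈ I_{lk}} M(y) -/
def MLK (M : ℝ → ℝ) (l k : ℕ) : ℝ := sSup (M '' dyadic l k)

/-- the local rate ζ_n(x) = (n/log n)^{t(x)/(2t(x)+1)} -/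
def zeta (t : ℝ → ℝ) (n : ℕ) (x : ℝ) : ℝ :=
  ((n : ℝ) / Real.log n) ^ (t x / (2 * t x + 1))

/-- maximal resolution L_max = ⌊log₂ n⌋ -/
def Lmax (n : ℕ) : ℕ := Nat.log 2 n

/-- C_l(x) = (2 M_{l k_l(x)}/γ̄)^{1/(t(x)+1/2)} -/
def Cl (t M : ℝ → ℝ) (γ : ℝ) (l : ℕ) (x : ℝ) : ℝ :=
  (2 * MLK M l (kAt l x) / γ) ^ ((1 : ℝ) / (t x + 1 / 2))

/-- the local depth d_l(x) -/
def dloc (t M : ℝ → ℝ) (γ : ℝ) (n l : ℕ) (x : ℝ) : ℝ :=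
  (⌊Real.logb 2 (Cl t M γ l x * ((n : ℝ) / Real.log n) ^ ((1 : ℝ) / (2 * t x + 1)))⌋ : ℝ)

/-- the adjusted local depth d̃_l(x) -/
def dTilde (t M η : ℝ → ℝ) (γ : ℝ) (n l : ℕ) (x : ℝ) : ℝ :=
  max (Real.logb 2 (1 / (2 * etaLK η l (kAt l x)))) (dloc t M γ n l x)


/-! ## The repulsive partition model -/

/-- knots of the grid -/
abbrev Knot (N : ℕ) := Fin (N + 1)

/-- the grid z₀ = 0 < … < z_N = 1 with spacing between C₁ log n/n and C₂ log n/n -/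
def IsGrid (n N : ℕ) (z : Knot N → ℝ) (C₁ C₂ : ℝ) : Prop :=
  z 0 = 0 ∧ z (Fin.last N) = 1 ∧
    ∀ i : Fin N,
      C₁ * Real.log n / n ≤ z i.succ - z i.castSucc ∧
      z i.succ - z i.castSucc ≤ C₂ * Real.log n / n

/-- a subset of knots defining a partition of [0,1] -/
def IsPart (N : ℕ) (S : Finset (Knot N)) : Prop := 0 ∈ S ∧ Fin.last N ∈ S

/-- i and j are consecutive knots of S (so that (z_i, z_j] is a block of S) -/
def Consec (N : ℕ) (S : Finset (Knot N)) (i j : Knot N) : Prop :=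
  i ∈ S ∧ j ∈ S ∧ i < j ∧ ∀ m ∈ S, ¬(i < m ∧ m < j)

/-- the (unnormalised) repulsive prior weight π_S(S) ∝ Π_j |I_j^S|^B -/
def partWeight (N : ℕ) (z : Knot N → ℝ) (B : ℝ) (S : Finset (Knot N)) : ℝ :=
  if IsPart N S then
    ∏ q ∈ Finset.univ.filter (fun q : Knot N × Knot N => Consec N S q.1 q.2),
      (z q.2 - z q.1) ^ B
  else 0

/-- conditions on the coefficient densities g_j: bounded above by c₁ and below by c₀
on [−B₀,B₀], nonnegative probability densities -/
def GoodDens (N : ℕ) (g : Knot N → ℝ → ℝ) (c₀ c₁ B₀ : ℝ) : Prop :=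
  ∀ i : Knot N,
    (∀ b : ℝ, |b| ≤ B₀ → c₀ ≤ g i b) ∧ (∀ b : ℝ, 0 ≤ g i b) ∧
      (∀ b : ℝ, g i b ≤ c₁) ∧ (∫ b : ℝ, g i b) = 1

/-- the conditional prior on the block coefficients given a partition S -/
def partCondPrior (N : ℕ) (g : Knot N → ℝ → ℝ) (S : Finset (Knot N)) :
    Measure (Knot N → ℝ) :=
  Measure.map
    (fun v : {i : Knot N // i ∈ S.erase 0} → ℝ =>
      fun i => if h : i ∈ S.erase 0 then v ⟨i, h⟩ else 0)
    ((volume : Measure ({i : Knot N // i ∈ S.erase 0} → ℝ)).withDensity fun v =>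
      ENNReal.ofReal (∏ i, g i.1 (v i)))

/-- the step function f_β^S = Σ_j β_j 1_{I_j^S} (the block (z_i,z_j] carries the
coefficient indexed by its right knot j) -/
def fPart (N : ℕ) (z : Knot N → ℝ) (S : Finset (Knot N)) (β : Knot N → ℝ) (x : ℝ) : ℝ :=
  ∑ j : Knot N, ∑ i : Knot N,
    if Consec N S i j ∧ x ∈ Set.Ioc (z i) (z j) then β j else 0

/-- the regression log-likelihood -/
def partLoglik (n N : ℕ) (z : Knot N → ℝ) (xd : Fin n → ℝ) (Y : Fin n → ℝ)
    (S : Finset (Knot N)) (β : Knot N → ℝ) : ℝ :=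
  -(1 / 2 : ℝ) * ∑ i, (Y i - fPart N z S β (xd i)) ^ 2

/-- the posterior probability of an event A about (S,β) -/
def partPost (n N : ℕ) (z : Knot N → ℝ) (xd : Fin n → ℝ) (B : ℝ)
    (g : Knot N → ℝ → ℝ) (Y : Fin n → ℝ)
    (A : Finset (Knot N) → (Knot N → ℝ) → Prop) : ℝ :=
  (∑ S : Finset (Knot N), partWeight N z B S *
      ∫ β, (if A S β then (1 : ℝ) else 0) * Real.exp (partLoglik n N z xd Y S β)
        ∂partCondPrior N g S) /
    ∑ S : Finset (Knot N), partWeight N z B S *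
      ∫ β, Real.exp (partLoglik n N z xd Y S β) ∂partCondPrior N g S

/-- n_I : number of design points in (a,b] -/
def nIv (n : ℕ) (xd : Fin n → ℝ) (a b : ℝ) : ℕ :=
  (Finset.univ.filter fun i => xd i ∈ Set.Ioc a b).card

/-- ȳ_I : the mean of Y over the design points in (a,b] -/
def ybar (n : ℕ) (xd : Fin n → ℝ) (Y : Fin n → ℝ) (a b : ℝ) : ℝ :=
  (∑ i ∈ Finset.univ.filter fun i => xd i ∈ Set.Ioc a b, Y i) / nIv n xd a b

/-- the intervals arising as the block I_x^S of some partition S ∈ 𝕊 -/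
def IxPairs (N : ℕ) (z : Knot N → ℝ) (x : ℝ) : Set (Knot N × Knot N) :=
  {q | ∃ S : Finset (Knot N), IsPart N S ∧ Consec N S q.1 q.2 ∧
    x ∈ Set.Ioc (z q.1) (z q.2)}

/-- the intervals I(x) : blocks of some S which contain x or are adjacent to the
block of S containing x -/
def IcalPairs (N : ℕ) (z : Knot N → ℝ) (x : ℝ) : Set (Knot N × Knot N) :=
  {q | ∃ S : Finset (Knot N), IsPart N S ∧ Consec N S q.1 q.2 ∧
    (x ∈ Set.Ioc (z q.1) (z q.2) ∨
      ∃ i j : Knot N, Consec N S i j ∧ x ∈ Set.Ioc (z i) (z j) ∧ (q.1 = j ∨ q.2 = i))}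

/-- n_{I_x^S} -/
def nIx (n N : ℕ) (xd : Fin n → ℝ) (z : Knot N → ℝ) (S : Finset (Knot N)) (x : ℝ) : ℝ :=
  ∑ i : Knot N, ∑ j : Knot N,
    if Consec N S i j ∧ x ∈ Set.Ioc (z i) (z j) then (nIv n xd (z i) (z j) : ℝ) else 0

/-- ȳ_{I_x^S} -/
def ybarIx (n N : ℕ) (xd : Fin n → ℝ) (z : Knot N → ℝ) (Y : Fin n → ℝ)
    (S : Finset (Knot N)) (x : ℝ) : ℝ :=
  ∑ i : Knot N, ∑ j : Knot N,
    if Consec N S i j ∧ x ∈ Set.Ioc (z i) (z j) then ybar n xd Y (z i) (z j) else 0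

/-- the design event Ω_{n,x}(u₁) -/
def OmegaX (n N : ℕ) (xd : Fin n → ℝ) (z : Knot N → ℝ) (pI : ℝ → ℝ → ℝ)
    (u₁ : ℝ) (x : ℝ) : Prop :=
  ∀ q ∈ IcalPairs N z x,
    |(nIv n xd (z q.1) (z q.2) : ℝ) - n * pI (z q.1) (z q.2)| ≤
      u₁ * Real.sqrt (Real.log n * (n * pI (z q.1) (z q.2)))

/-- the noise event Ω_{n,y}(u₀) -/
def OmegaY (n N : ℕ) (xd : Fin n → ℝ) (z : Knot N → ℝ) (u₀ : ℝ) (x : ℝ)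
    (ε : Fin n → ℝ) : Prop :=
  ∀ q ∈ IxPairs N z x,
    |ybar n xd ε (z q.1) (z q.2)| ≤
      u₀ * Real.sqrt (Real.log n / nIv n xd (z q.1) (z q.2))

/-- the noise event Ω_{n,y,2}(u₂) -/
def OmegaY2 (n N : ℕ) (xd : Fin n → ℝ) (z : Knot N → ℝ) (u₂ : ℝ) (x : ℝ)
    (ε : Fin n → ℝ) : Prop :=
  ∀ q ∈ IcalPairs N z x,
    |ybar n xd ε (z q.1) (z q.2)| ≤
      u₂ * Real.sqrt (Real.log n / nIv n xd (z q.1) (z q.2))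

/-- the local rate ε_n(x) = (n/log n)^{−t(x)/(2t(x)+1)} -/
def epsn (t : ℝ → ℝ) (n : ℕ) (x : ℝ) : ℝ :=
  ((n : ℝ) / Real.log n) ^ (-(t x) / (2 * t x + 1))

/-- s_n(δ) = δ log n / ε_n² -/
def snD (t : ℝ → ℝ) (n : ℕ) (x : ℝ) (δ : ℝ) : ℝ :=
  δ * Real.log n / epsn t n x ^ 2

/-- the standard Gaussian on ℝ -/
def stdGaussian : Measure ℝ := ProbabilityTheory.gaussianReal 0 1

/-- the regression noise distribution -/
def regNoise (n : ℕ) : Measure (Fin n → ℝ) := Measure.pi fun _ => stdGaussian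

/-- Assumption A4: the smoothness exponent t is piecewise Hölder -/
def A4 (t : ℝ → ℝ) : Prop :=
  ∃ k : ℕ, ∃ a : Fin (k + 2) → ℝ, a 0 = 0 ∧ a (Fin.last (k + 1)) = 1 ∧ StrictMono a ∧
    ∃ L₀ > (0 : ℝ), ∀ j : Fin (k + 1), ∃ α > (0 : ℝ),
      (∀ x ∈ Set.Ioo (a j.castSucc) (a j.succ), ∀ y ∈ Set.Ioo (a j.castSucc) (a j.succ),
        |t x - t y| ≤ L₀ * |x - y| ^ α) ∧
      (∀ x ∈ Set.Ioo (a j.castSucc) (a j.succ),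
        |t x - t (a j.castSucc)| ≤ L₀ * |x - a j.castSucc| ^ α ∧
        |t x - t (a j.succ)| ≤ L₀ * |x - a j.succ| ^ α)

section Partitions

variable {N : ℕ}

/-- the pairs of consecutive knots of `S` -/
def consecPairs (S : Finset (Knot N)) : Finset (Knot N × Knot N) :=
  Finset.univ.filter fun q => Consec N S q.1 q.2

/-- the product of the block weights `T` over the blocks of `S` -/
def blockProd (T : Knot N → Knot N → ℝ) (S : Finset (Knot N)) : ℝ :=
  ∏ q ∈ consecPairs S, T q.1 q.2

/-- the knot sets which define a partition -/
def parts (N : ℕ) : Finset (Finset (Knot N)) := Finset.univ.filter fun S => IsPart N S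

/-- the total mass of all partitions for the block weights `T` -/
def totalMass (T : Knot N → Knot N → ℝ) : ℝ := ∑ S ∈ parts N, blockProd T S

lemma mem_consecPairs {S : Finset (Knot N)} {q : Knot N × Knot N} :
    q ∈ consecPairs S ↔ Consec N S q.1 q.2 := by
  simp [consecPairs]

lemma consecPairs_insert {S : Finset (Knot N)} {i j k : Knot N} (h : Consec N S i k)
    (hij : i < j) (hjk : j < k) :
    consecPairs (insert j S) =
      insert (i, j) (insert (j, k) ((consecPairs S).erase (i, k))) := by
  obtain ⟨hi, hk, hik, hm⟩ := h
  ext ⟨p, q⟩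
  simp only [mem_consecPairs, Consec, Finset.mem_insert, Finset.mem_erase, Prod.mk.injEq, ne_eq]
  constructor
  · rintro ⟨hp, hq, hpq, hn⟩
    have hi' := hn i (Or.inr hi)
    have hk' := hn k (Or.inr hk)
    have hj' := hn j (Or.inl rfl)
    have hpm : p = j ∨ ¬(i < p ∧ p < k) := hp.imp id (hm p)
    have hqm : q = j ∨ ¬(i < q ∧ q < k) := hq.imp id (hm q)
    grind
  · rintro (⟨rfl, rfl⟩ | ⟨rfl, rfl⟩ | ⟨hne, hp, hq, hpq, hn⟩)
    · refine ⟨Or.inr hi, Or.inl rfl, hij, ?_⟩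
      rintro m (rfl | hmS) ⟨h1, h2⟩
      · exact lt_irrefl _ h2
      · exact hm m hmS ⟨h1, h2.trans hjk⟩
    · refine ⟨Or.inl rfl, Or.inr hk, hjk, ?_⟩
      rintro m (rfl | hmS) ⟨h1, h2⟩
      · exact lt_irrefl _ h1
      · exact hm m hmS ⟨hij.trans h1, h2⟩
    · refine ⟨Or.inr hp, Or.inr hq, hpq, ?_⟩
      rintro m (rfl | hmS) ⟨h1, h2⟩
      · have hi' := hn i hi
        have hk' := hn k hk
        have hp' := hm p hp
        have hq' := hm q hq
        grind
      · exact hn m hmS ⟨h1, h2⟩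

lemma blockProd_insert (T : Knot N → Knot N → ℝ) {S : Finset (Knot N)} {i j k : Knot N}
    (h : Consec N S i k) (hij : i < j) (hjk : j < k) :
    blockProd T (insert j S) * T i k = blockProd T S * (T i j * T j k) := by
  have hj : j ∉ S := fun hj => h.2.2.2 j hj ⟨hij, hjk⟩
  have hmem : (i, k) ∈ consecPairs S := by simpa [consecPairs] using h
  have h1 : (i, j) ∉ insert (j, k) ((consecPairs S).erase (i, k)) := by
    simp only [mem_consecPairs, Consec, Finset.mem_insert, Finset.mem_erase, Prod.mk.injEq]
    rintro (⟨rfl, -⟩ | ⟨-, -, hj', -⟩)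
    · exact lt_irrefl _ hij
    · exact hj hj'
  have h2 : (j, k) ∉ (consecPairs S).erase (i, k) := by
    simp only [mem_consecPairs, Consec, Finset.mem_erase]
    rintro ⟨-, hj', -⟩
    exact hj hj'
  unfold blockProd
  rw [consecPairs_insert h hij hjk, Finset.prod_insert h1, Finset.prod_insert h2,
    ← Finset.mul_prod_erase _ _ hmem]
  ring

lemma Consec.erase {S : Finset (Knot N)} {i j k : Knot N} (hij : Consec N S i j)
    (hjk : Consec N S j k) : Consec N (S.erase j) i k := by
  obtain ⟨hi, hj, hlt, hm⟩ := hij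
  obtain ⟨-, hk, hlt', hm'⟩ := hjk
  refine ⟨Finset.mem_erase.2 ⟨hlt.ne, hi⟩, Finset.mem_erase.2 ⟨hlt'.ne', hk⟩, hlt.trans hlt', ?_⟩
  rintro m hmS ⟨h1, h2⟩
  obtain ⟨hne, hmS⟩ := Finset.mem_erase.1 hmS
  rcases lt_or_gt_of_ne hne with h | h
  · exact hm m hmS ⟨h1, h⟩
  · exact hm' m hmS ⟨h, h2⟩

lemma blockProd_erase (T : Knot N → Knot N → ℝ) {S : Finset (Knot N)} {i j k : Knot N}
    (hij : Consec N S i j) (hjk : Consec N S j k) :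
    blockProd T S * T i k = blockProd T (S.erase j) * (T i j * T j k) := by
  have h := blockProd_insert T (hij.erase hjk) hij.2.2.1 hjk.2.2.1
  rwa [Finset.insert_erase hij.2.1] at h

lemma isPart_erase {S : Finset (Knot N)} (hS : IsPart N S) {i j k : Knot N}
    (hij : i < j) (hjk : j < k) : IsPart N (S.erase j) :=
  ⟨Finset.mem_erase.2 ⟨((Fin.zero_le i).trans_lt hij).ne, hS.1⟩,
    Finset.mem_erase.2 ⟨(hjk.trans_le (Fin.le_last k)).ne', hS.2⟩⟩

lemma blockProd_pos {T : Knot N → Knot N → ℝ} (hT : ∀ i j, i < j → 0 < T i j)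
    (S : Finset (Knot N)) : 0 < blockProd T S :=
  Finset.prod_pos fun q hq => hT _ _ (by
    simp only [consecPairs, Finset.mem_filter] at hq
    exact hq.2.2.2.1)

lemma sum_blockProd_le_of_injOn {T : Knot N → Knot N → ℝ} (hT : ∀ i j, i < j → 0 < T i j)
    {𝒜 : Finset (Finset (Knot N))} (φ : Finset (Knot N) → Finset (Knot N))
    (hφ : ∀ S ∈ 𝒜, φ S ∈ parts N) (hinj : Set.InjOn φ 𝒜) {R : ℝ} (hR : 0 ≤ R)
    (hle : ∀ S ∈ 𝒜, blockProd T S ≤ R * blockProd T (φ S)) :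
    ∑ S ∈ 𝒜, blockProd T S ≤ R * totalMass T := by
  calc ∑ S ∈ 𝒜, blockProd T S ≤ ∑ S ∈ 𝒜, R * blockProd T (φ S) := Finset.sum_le_sum hle
    _ = R * ∑ S ∈ 𝒜.image φ, blockProd T S := by
        rw [Finset.sum_image hinj, Finset.mul_sum]
    _ ≤ R * totalMass T := by
        refine mul_le_mul_of_nonneg_left ?_ hR
        refine Finset.sum_le_sum_of_subset_of_nonneg ?_ fun S _ _ => (blockProd_pos hT S).le
        intro S hS
        obtain ⟨S', hS', rfl⟩ := Finset.mem_image.1 hS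
        exact hφ _ hS'

/-- Comparison with the partitions in which the knot `j` is deleted. -/
lemma sum_blockProd_le_of_merge {T : Knot N → Knot N → ℝ} (hT : ∀ i j, i < j → 0 < T i j)
    {𝒜 : Finset (Finset (Knot N))} (h𝒜 : 𝒜 ⊆ parts N) (j : Knot N) {R : ℝ} (hR : 0 ≤ R)
    (h : ∀ S ∈ 𝒜, ∃ i k, Consec N S i j ∧ Consec N S j k ∧ T i j * T j k ≤ R * T i k) :
    ∑ S ∈ 𝒜, blockProd T S ≤ R * totalMass T := by
  refine sum_blockProd_le_of_injOn hT (fun S => S.erase j) ?_ ?_ hR ?_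
  · intro S hS
    obtain ⟨i, k, hij, hjk, -⟩ := h S hS
    have hP : IsPart N S := (Finset.mem_filter.1 (h𝒜 hS)).2
    exact Finset.mem_filter.2 ⟨Finset.mem_univ _, isPart_erase hP hij.2.2.1 hjk.2.2.1⟩
  · intro S hS S' hS' hE
    obtain ⟨i, k, hij, -⟩ := h S hS
    obtain ⟨i', k', hij', -⟩ := h S' hS'
    rw [← Finset.insert_erase hij.2.1, ← Finset.insert_erase hij'.2.1]
    exact congrArg _ hE
  · intro S hS
    obtain ⟨i, k, hij, hjk, hle⟩ := h S hS
    have hpos := hT i k (hij.2.2.1.trans hjk.2.2.1)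
    refine le_of_mul_le_mul_right ?_ hpos
    rw [blockProd_erase T hij hjk]
    calc blockProd T (S.erase j) * (T i j * T j k)
        ≤ blockProd T (S.erase j) * (R * T i k) :=
          mul_le_mul_of_nonneg_left hle (blockProd_pos hT _).le
      _ = R * blockProd T (S.erase j) * T i k := by ring

/-- Comparison with the partitions in which the knot `j` is replaced by `m`. -/
lemma sum_blockProd_le_of_move {T : Knot N → Knot N → ℝ} (hT : ∀ i j, i < j → 0 < T i j)
    {𝒜 : Finset (Finset (Knot N))} (h𝒜 : 𝒜 ⊆ parts N) (j m : Knot N) {R : ℝ} (hR : 0 ≤ R)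
    (h : ∀ S ∈ 𝒜, ∃ i k, Consec N S i j ∧ Consec N S j k ∧ j < m ∧ m < k ∧
      T i j * T j k ≤ R * (T i m * T m k)) :
    ∑ S ∈ 𝒜, blockProd T S ≤ R * totalMass T := by
  refine sum_blockProd_le_of_injOn hT (fun S => insert m (S.erase j)) ?_ ?_ hR ?_
  · intro S hS
    obtain ⟨i, k, hij, hjk, -⟩ := h S hS
    have hP : IsPart N S := (Finset.mem_filter.1 (h𝒜 hS)).2
    have := isPart_erase hP hij.2.2.1 hjk.2.2.1
    exact Finset.mem_filter.2 ⟨Finset.mem_univ _, Finset.mem_insert_of_mem this.1,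
      Finset.mem_insert_of_mem this.2⟩
  · intro S hS S' hS' hE
    obtain ⟨i, k, hij, hjk, hjm, hmk, -⟩ := h S hS
    obtain ⟨i', k', hij', hjk', hjm', hmk', -⟩ := h S' hS'
    have hm : m ∉ S.erase j := fun hm =>
      hjk.2.2.2 m (Finset.mem_of_mem_erase hm) ⟨hjm, hmk⟩
    have hm' : m ∉ S'.erase j := fun hm =>
      hjk'.2.2.2 m (Finset.mem_of_mem_erase hm) ⟨hjm', hmk'⟩
    have hE' : S.erase j = S'.erase j := by
      rw [← Finset.erase_insert hm, ← Finset.erase_insert hm']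
      exact congrArg (fun U => Finset.erase U m) hE
    rw [← Finset.insert_erase hij.2.1, ← Finset.insert_erase hij'.2.1, hE']
  · intro S hS
    obtain ⟨i, k, hij, hjk, hjm, hmk, hle⟩ := h S hS
    have hpos := hT i k (hij.2.2.1.trans hjk.2.2.1)
    refine le_of_mul_le_mul_right ?_ hpos
    have hins := blockProd_insert T (hij.erase hjk) (hij.2.2.1.trans hjm) hmk
    rw [blockProd_erase T hij hjk, mul_assoc, hins]
    calc blockProd T (S.erase j) * (T i j * T j k)
        ≤ blockProd T (S.erase j) * (R * (T i m * T m k)) :=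
          mul_le_mul_of_nonneg_left hle (blockProd_pos hT _).le
      _ = R * (blockProd T (S.erase j) * (T i m * T m k)) := by ring

lemma le_rpow_mul_of_le {a R Z θ : ℝ} (hR : 0 ≤ R) (hZ : 0 ≤ Z) (hθ : θ ≤ 1) (hθ₀ : 0 ≤ θ)
    (h₁ : a ≤ Z) (h₂ : a ≤ R * Z) : a ≤ R ^ θ * Z := by
  rcases le_total R 1 with h | h
  · refine h₂.trans (mul_le_mul_of_nonneg_right ?_ hZ)
    rcases hR.eq_or_lt with rfl | hpos
    · exact Real.rpow_nonneg le_rfl _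
    · simpa using Real.rpow_le_rpow_of_exponent_ge hpos h hθ
  · exact h₁.trans (le_mul_of_one_le_left hZ (Real.one_le_rpow h hθ₀))

/-- The mass of a family of partitions containing one of the blocks of `Q`, bounded by merging
each such block with its right neighbour or by moving its right end point. -/
theorem sum_blockProd_le {T : Knot N → Knot N → ℝ} (hT : ∀ i j, i < j → 0 < T i j)
    {𝒜 : Finset (Finset (Knot N))} (h𝒜 : 𝒜 ⊆ parts N) (Q : Finset (Knot N × Knot N))
    (near : Knot N → Finset (Knot N)) (m : Knot N → Knot N)
    (R : Knot N × Knot N → Knot N → ℝ) (X : Knot N × Knot N → ℝ) {V θ : ℝ}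
    (hR : ∀ q k, 0 ≤ R q k) (hX : ∀ q, 0 ≤ X q) (hV : 0 ≤ V) (hθ : θ ≤ 1) (hθ₀ : 0 ≤ θ)
    (hQ : ∀ S ∈ 𝒜, ∃ q ∈ Q, Consec N S q.1 q.2 ∧ ∃ k, Consec N S q.2 k)
    (hnear : ∀ q ∈ Q, ∀ k ∈ near q.2, q.2 < k →
      T q.1 q.2 * T q.2 k ≤ R q k * T q.1 k)
    (hfar : ∀ q ∈ Q, ∀ k ∉ near q.2, q.2 < k →
      T q.1 q.2 * T q.2 k ≤ X q * T q.1 k ∨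
        (q.2 < m q.2 ∧ m q.2 < k ∧
          T q.1 q.2 * T q.2 k ≤ V * (T q.1 (m q.2) * T (m q.2) k))) :
    ∑ S ∈ 𝒜, blockProd T S ≤
      (∑ q ∈ Q, (∑ k ∈ near q.2, R q k ^ θ + X q ^ θ + V)) * totalMass T := by
  have hZ : 0 ≤ totalMass T := Finset.sum_nonneg fun S _ => (blockProd_pos hT S).le
  have htriv : ∀ 𝒞 ⊆ 𝒜, ∑ S ∈ 𝒞, blockProd T S ≤ totalMass T := fun 𝒞 h𝒞 =>
    Finset.sum_le_sum_of_subset_of_nonneg (h𝒞.trans h𝒜) fun S _ _ => (blockProd_pos hT S).le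
  have hnn : ∀ S, 0 ≤ blockProd T S := fun S => (blockProd_pos hT S).le
  set 𝒩 : Knot N × Knot N → Knot N → Finset (Finset (Knot N)) := fun q k =>
    𝒜.filter fun S => Consec N S q.1 q.2 ∧ Consec N S q.2 k with h𝒩
  set 𝒳 : Knot N × Knot N → Finset (Finset (Knot N)) := fun q =>
    𝒜.filter fun S => ∃ k, Consec N S q.1 q.2 ∧ Consec N S q.2 k ∧
      T q.1 q.2 * T q.2 k ≤ X q * T q.1 k with h𝒳
  set 𝒱 : Knot N × Knot N → Finset (Finset (Knot N)) := fun q =>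
    𝒜.filter fun S => ∃ k, Consec N S q.1 q.2 ∧ Consec N S q.2 k ∧ q.2 < m q.2 ∧ m q.2 < k ∧
      T q.1 q.2 * T q.2 k ≤ V * (T q.1 (m q.2) * T (m q.2) k) with h𝒱
  have hcover : 𝒜 ⊆ Q.biUnion fun q => ((near q.2).biUnion (𝒩 q)) ∪ 𝒳 q ∪ 𝒱 q := by
    intro S hS
    obtain ⟨q, hq, hc, k, hk⟩ := hQ S hS
    refine Finset.mem_biUnion.2 ⟨q, hq, ?_⟩
    by_cases hkn : k ∈ near q.2
    · refine Finset.mem_union_left _ (Finset.mem_union_left _ ?_)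
      exact Finset.mem_biUnion.2 ⟨k, hkn, Finset.mem_filter.2 ⟨hS, hc, hk⟩⟩
    · rcases hfar q hq k hkn hk.2.2.1 with h | h
      · refine Finset.mem_union_left _ (Finset.mem_union_right _ ?_)
        exact Finset.mem_filter.2 ⟨hS, k, hc, hk, h⟩
      · refine Finset.mem_union_right _ ?_
        exact Finset.mem_filter.2 ⟨hS, k, hc, hk, h⟩
  have hun : ∀ 𝒞 𝒟 : Finset (Finset (Knot N)),
      ∑ S ∈ 𝒞 ∪ 𝒟, blockProd T S ≤ ∑ S ∈ 𝒞, blockProd T S + ∑ S ∈ 𝒟, blockProd T S := by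
    intro 𝒞 𝒟
    rw [← Finset.sum_union_inter]
    exact le_add_of_nonneg_right (Finset.sum_nonneg fun S _ => hnn S)
  have hbi : ∀ {ι : Type} (s : Finset ι) (F : ι → Finset (Finset (Knot N))),
      ∑ S ∈ s.biUnion F, blockProd T S ≤ ∑ a ∈ s, ∑ S ∈ F a, blockProd T S := by
    intro ι s F
    induction s using Finset.induction_on with
    | empty => simp
    | insert a s ha ih =>
      rw [Finset.biUnion_insert, Finset.sum_insert ha]
      exact (hun _ _).trans (by gcongr)
  calc ∑ S ∈ 𝒜, blockProd T S
      ≤ ∑ S ∈ Q.biUnion (fun q => ((near q.2).biUnion (𝒩 q)) ∪ 𝒳 q ∪ 𝒱 q), blockProd T S :=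
        Finset.sum_le_sum_of_subset_of_nonneg hcover fun S _ _ => hnn S
    _ ≤ ∑ q ∈ Q, ∑ S ∈ ((near q.2).biUnion (𝒩 q)) ∪ 𝒳 q ∪ 𝒱 q, blockProd T S := hbi _ _
    _ ≤ ∑ q ∈ Q, (∑ k ∈ near q.2, R q k ^ θ + X q ^ θ + V) * totalMass T := by
        refine Finset.sum_le_sum fun q hq => ?_
        refine (hun _ _).trans ?_
        rw [add_mul, add_mul, Finset.sum_mul]
        refine add_le_add ((hun _ _).trans (add_le_add ((hbi _ _).trans ?_) ?_)) ?_
        · refine Finset.sum_le_sum fun k hk => ?_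
          refine le_rpow_mul_of_le (hR q k) hZ hθ hθ₀ (htriv _ (Finset.filter_subset _ _)) ?_
          refine sum_blockProd_le_of_merge hT ((Finset.filter_subset _ _).trans h𝒜) q.2 (hR q k)
            fun S hS => ?_
          obtain ⟨-, h1, h2⟩ := Finset.mem_filter.1 hS
          exact ⟨q.1, k, h1, h2, hnear q hq k hk h2.2.2.1⟩
        · refine le_rpow_mul_of_le (hX q) hZ hθ hθ₀ (htriv _ (Finset.filter_subset _ _)) ?_
          refine sum_blockProd_le_of_merge hT ((Finset.filter_subset _ _).trans h𝒜) q.2 (hX q)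
            fun S hS => ?_
          obtain ⟨-, k, h1, h2, h3⟩ := Finset.mem_filter.1 hS
          exact ⟨q.1, k, h1, h2, h3⟩
        · refine sum_blockProd_le_of_move hT ((Finset.filter_subset _ _).trans h𝒜) q.2 (m q.2) hV
            fun S hS => ?_
          obtain ⟨-, k, h1, h2, h3⟩ := Finset.mem_filter.1 hS
          exact ⟨q.1, k, h1, h2, h3⟩
    _ = _ := by rw [Finset.sum_mul]

end Partitions

section Posterior

/-- the design points in `(a, b]` -/
def dataIn {n : ℕ} (xd : Fin n → ℝ) (a b : ℝ) : Finset (Fin n) :=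
  Finset.univ.filter fun i => xd i ∈ Set.Ioc a b

/-- the marginal likelihood of the observations in `s` under a constant mean with density `g` -/
def blockLik {n : ℕ} (g : ℝ → ℝ) (Y : Fin n → ℝ) (s : Finset (Fin n)) : ℝ :=
  ∫ b, g b * Real.exp (-(1 / 2) * ∑ i ∈ s, (Y i - b) ^ 2)

/-- the posterior weight of the block `(z i, z j]` -/
def blockWeight {n N : ℕ} (z : Knot N → ℝ) (xd : Fin n → ℝ) (B : ℝ) (g : Knot N → ℝ → ℝ)
    (Y : Fin n → ℝ) (i j : Knot N) : ℝ :=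
  (z j - z i) ^ B * blockLik (g j) Y (dataIn xd (z i) (z j))

variable {n N : ℕ} {z : Knot N → ℝ}

lemma exists_consec_left {S : Finset (Knot N)} (h0 : 0 ∈ S) {j : Knot N} (hj : j ∈ S)
    (hj0 : j ≠ 0) : ∃ i, Consec N S i j := by
  have hne : (S.filter (· < j)).Nonempty :=
    ⟨0, Finset.mem_filter.2 ⟨h0, Fin.pos_iff_ne_zero.2 hj0⟩⟩
  have hm := Finset.max'_mem _ hne
  refine ⟨(S.filter (· < j)).max' hne, (Finset.mem_filter.1 hm).1, hj,
    (Finset.mem_filter.1 hm).2, ?_⟩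
  rintro m hmS ⟨h1, h2⟩
  exact absurd (Finset.le_max' _ m (Finset.mem_filter.2 ⟨hmS, h2⟩)) (not_le.2 h1)

lemma exists_consec_right {S : Finset (Knot N)} (hl : Fin.last N ∈ S) {j : Knot N} (hj : j ∈ S)
    (hjl : j ≠ Fin.last N) : ∃ k, Consec N S j k := by
  have hne : (S.filter (j < ·)).Nonempty :=
    ⟨Fin.last N, Finset.mem_filter.2 ⟨hl, Fin.lt_last_iff_ne_last.2 hjl⟩⟩
  have hm := Finset.min'_mem _ hne
  refine ⟨(S.filter (j < ·)).min' hne, hj, (Finset.mem_filter.1 hm).1,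
    (Finset.mem_filter.1 hm).2, ?_⟩
  rintro m hmS ⟨h1, h2⟩
  exact absurd (Finset.min'_le _ m (Finset.mem_filter.2 ⟨hmS, h1⟩)) (not_le.2 h2)

lemma Consec.left_unique {S : Finset (Knot N)} {i i' j : Knot N} (h : Consec N S i j)
    (h' : Consec N S i' j) : i = i' := by
  rcases lt_trichotomy i i' with hlt | rfl | hlt
  · exact absurd ⟨hlt, h'.2.2.1⟩ (h.2.2.2 i' h'.1)
  · rfl
  · exact absurd ⟨hlt, h.2.2.1⟩ (h'.2.2.2 i h.1)

lemma exists_consec_mem {S : Finset (Knot N)} (hS : IsPart N S) {x : ℝ}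
    (hx : x ∈ Set.Ioc (z 0) (z (Fin.last N))) :
    ∃ i j, Consec N S i j ∧ x ∈ Set.Ioc (z i) (z j) := by
  have hne : (S.filter (x ≤ z ·)).Nonempty := ⟨Fin.last N, Finset.mem_filter.2 ⟨hS.2, hx.2⟩⟩
  obtain ⟨j, hj, hmin⟩ := Finset.exists_min_image _ id hne
  obtain ⟨hjS, hxj⟩ := Finset.mem_filter.1 hj
  have hj0 : j ≠ 0 := fun h => absurd hx.1 (not_lt.2 (h ▸ hxj))
  obtain ⟨i, hi⟩ := exists_consec_left hS.1 hjS hj0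
  refine ⟨i, j, hi, ?_, hxj⟩
  by_contra hxi
  exact absurd (hmin i (Finset.mem_filter.2 ⟨hi.1, not_lt.1 hxi⟩)) (not_le.2 hi.2.2.1)

lemma consec_mem_unique (hz : StrictMono z) {S : Finset (Knot N)} {x : ℝ} {i j i' j' : Knot N}
    (h : Consec N S i j) (hx : x ∈ Set.Ioc (z i) (z j))
    (h' : Consec N S i' j') (hx' : x ∈ Set.Ioc (z i') (z j')) : i = i' ∧ j = j' := by
  have h1 : i < j' := hz.lt_iff_lt.1 (hx.1.trans_le hx'.2)
  have h2 : i' < j := hz.lt_iff_lt.1 (hx'.1.trans_le hx.2)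
  have hj : j = j' := le_antisymm (not_lt.1 fun h3 => h.2.2.2 j' h'.2.1 ⟨h1, h3⟩)
    (not_lt.1 fun h3 => h'.2.2.2 j h.2.1 ⟨h2, h3⟩)
  subst hj
  exact ⟨h.left_unique h', rfl⟩

lemma fPart_eq (hz : StrictMono z) {S : Finset (Knot N)} {x : ℝ} {i j : Knot N}
    (h : Consec N S i j) (hx : x ∈ Set.Ioc (z i) (z j)) (β : Knot N → ℝ) :
    fPart N z S β x = β j := by
  unfold fPart
  rw [Finset.sum_eq_single j, Finset.sum_eq_single i]
  · simp [h, hx.1, hx.2]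
  · intro i' _ hne
    exact if_neg fun hc => hne (consec_mem_unique hz hc.1 hc.2 h hx).1
  · simp
  · intro j' _ hne
    exact Finset.sum_eq_zero fun i' _ =>
      if_neg fun hc => hne (consec_mem_unique hz hc.1 hc.2 h hx).2
  · simp

lemma fPart_eq_zero (hz : StrictMono z) {S : Finset (Knot N)} {x : ℝ}
    (hx : x ∉ Set.Ioc (z 0) (z (Fin.last N))) (β : Knot N → ℝ) : fPart N z S β x = 0 := by
  refine Finset.sum_eq_zero fun j _ => Finset.sum_eq_zero fun i _ => if_neg fun hc => hx ?_
  exact ⟨(hz.monotone (Fin.zero_le i)).trans_lt hc.2.1,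
    hc.2.2.trans (hz.monotone (Fin.le_last j))⟩

lemma integrable_of_integral_eq_one {g : ℝ → ℝ} (hg1 : ∫ b, g b = 1) : Integrable g := by
  by_contra h
  rw [integral_undef h] at hg1
  exact zero_ne_one hg1

lemma integrable_blockLik {g : ℝ → ℝ} (hgi : Integrable g)
    (Y : Fin n → ℝ) (s : Finset (Fin n)) :
    Integrable fun b => g b * Real.exp (-(1 / 2) * ∑ i ∈ s, (Y i - b) ^ 2) := by
  refine hgi.mul_bdd (c := 1) (by fun_prop) (ae_of_all _ fun b => ?_)
  rw [Real.norm_eq_abs, abs_of_pos (Real.exp_pos _), Real.exp_le_one_iff]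
  have : 0 ≤ ∑ i ∈ s, (Y i - b) ^ 2 := Finset.sum_nonneg fun i _ => sq_nonneg _
  linarith

lemma blockLik_pos {g : ℝ → ℝ} (hg0 : ∀ b, 0 ≤ g b) (hg1 : ∫ b, g b = 1)
    (Y : Fin n → ℝ) (s : Finset (Fin n)) : 0 < blockLik g Y s := by
  have hgi := integrable_of_integral_eq_one hg1
  unfold blockLik
  rw [integral_pos_iff_support_of_nonneg (fun b => mul_nonneg (hg0 b) (Real.exp_pos _).le)
    (integrable_blockLik hgi Y s)]
  have hsup : (Function.support fun b => g b * Real.exp (-(1 / 2) * ∑ i ∈ s, (Y i - b) ^ 2))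
      = Function.support g := by
    ext b
    simp [Real.exp_ne_zero]
  rw [hsup, ← integral_pos_iff_support_of_nonneg hg0 hgi, hg1]
  exact one_pos

/-- the contribution to the likelihood of the design points outside `(z 0, z N]` -/
def outsideLik (z : Knot N → ℝ) (xd : Fin n → ℝ) (Y : Fin n → ℝ) : ℝ :=
  Real.exp (-(1 / 2) * ∑ i with xd i ∉ Set.Ioc (z 0) (z (Fin.last N)), Y i ^ 2)

lemma sum_sq_fPart (hz : StrictMono z) {S : Finset (Knot N)} (hS : IsPart N S)
    (xd : Fin n → ℝ) (Y : Fin n → ℝ) (β : Knot N → ℝ) :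
    ∑ i, (Y i - fPart N z S β (xd i)) ^ 2 =
      (∑ i with xd i ∉ Set.Ioc (z 0) (z (Fin.last N)), Y i ^ 2) +
        ∑ q ∈ consecPairs S, ∑ i ∈ dataIn xd (z q.1) (z q.2), (Y i - β q.2) ^ 2 := by
  rw [← Finset.sum_filter_not_add_sum_filter _
    (fun i => xd i ∈ Set.Ioc (z 0) (z (Fin.last N)))]
  congr 1
  · refine Finset.sum_congr rfl fun i hi => ?_
    rw [fPart_eq_zero hz (Finset.mem_filter.1 hi).2, sub_zero]
  · have hU : (Finset.univ.filter fun i => xd i ∈ Set.Ioc (z 0) (z (Fin.last N))) =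
        (consecPairs S).biUnion fun q => dataIn xd (z q.1) (z q.2) := by
      ext i
      simp only [Finset.mem_filter, Finset.mem_univ, true_and, Finset.mem_biUnion, dataIn,
        mem_consecPairs, Prod.exists]
      constructor
      · intro hi
        exact exists_consec_mem hS hi
      · rintro ⟨p, q, hc, h1, h2⟩
        exact ⟨(hz.monotone (Fin.zero_le p)).trans_lt h1,
          h2.trans (hz.monotone (Fin.le_last q))⟩
    rw [hU, Finset.sum_biUnion]
    · refine Finset.sum_congr rfl fun q hq => Finset.sum_congr rfl fun i hi => ?_
      rw [fPart_eq hz (mem_consecPairs.1 hq) (Finset.mem_filter.1 hi).2]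
    · intro q hq q' hq' hne
      refine Finset.disjoint_left.2 fun i hi hi' => hne ?_
      have := consec_mem_unique hz (mem_consecPairs.1 hq) (Finset.mem_filter.1 hi).2
        (mem_consecPairs.1 hq') (Finset.mem_filter.1 hi').2
      exact Prod.ext this.1 this.2

lemma exp_partLoglik (hz : StrictMono z) {S : Finset (Knot N)} (hS : IsPart N S)
    (xd : Fin n → ℝ) (Y : Fin n → ℝ) (β : Knot N → ℝ) :
    Real.exp (partLoglik n N z xd Y S β) = outsideLik z xd Y *
      ∏ q ∈ consecPairs S,
        Real.exp (-(1 / 2) * ∑ i ∈ dataIn xd (z q.1) (z q.2), (Y i - β q.2) ^ 2) := by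
  unfold partLoglik outsideLik
  rw [sum_sq_fPart hz hS, mul_add, Real.exp_add, Finset.mul_sum (consecPairs S),
    Real.exp_sum]

lemma prod_consecPairs {S : Finset (Knot N)}
    (pred : {i : Knot N // i ∈ S.erase 0} → Knot N) (hpred : ∀ j, Consec N S (pred j) j)
    (F : Knot N → Knot N → ℝ) :
    ∏ q ∈ consecPairs S, F q.1 q.2 = ∏ j, F (pred j) j := by
  symm
  refine Finset.prod_bij (fun j _ => (pred j, j.1)) ?_ ?_ ?_ ?_
  · intro j _
    exact mem_consecPairs.2 (hpred j)
  · intro j _ j' _ h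
    exact Subtype.ext (Prod.ext_iff.1 h).2
  · intro q hq
    have hc := mem_consecPairs.1 hq
    have hq2 : q.2 ∈ S.erase 0 :=
      Finset.mem_erase.2 ⟨((Fin.zero_le q.1).trans_lt hc.2.2.1).ne', hc.2.1⟩
    refine ⟨⟨q.2, hq2⟩, Finset.mem_univ _, ?_⟩
    exact Prod.ext ((hpred ⟨q.2, hq2⟩).left_unique hc) rfl
  · intro j _
    rfl

lemma integral_partCondPrior {g : Knot N → ℝ → ℝ} (hg0 : ∀ i b, 0 ≤ g i b)
    (hg1 : ∀ i, ∫ b, g i b = 1) (S : Finset (Knot N)) {F : (Knot N → ℝ) → ℝ}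
    (hF : Continuous F) :
    ∫ β, F β ∂partCondPrior N g S =
      ∫ v : {i : Knot N // i ∈ S.erase 0} → ℝ, (∏ i, g i.1 (v i)) *
        F (fun i => if h : i ∈ S.erase 0 then v ⟨i, h⟩ else 0) := by
  have hgi : ∀ i, Integrable (g i) := fun i => integrable_of_integral_eq_one (hg1 i)
  unfold partCondPrior
  rw [integral_map]
  · rw [integral_withDensity_eq_integral_toReal_smul₀]
    · refine integral_congr_ae (ae_of_all _ fun v => ?_)
      simp only [smul_eq_mul]
      rw [ENNReal.toReal_ofReal (Finset.prod_nonneg fun i _ => hg0 _ _)]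
    · refine AEMeasurable.ennreal_ofReal ?_
      exact (Integrable.fintype_prod (f := fun i : {i : Knot N // i ∈ S.erase 0} => g i.1)
        (μ := fun _ => volume) fun i => hgi i.1).aemeasurable
    · exact ae_of_all _ fun v => ENNReal.ofReal_lt_top
  · refine Measurable.aemeasurable (measurable_pi_lambda _ fun i => ?_)
    split_ifs with h
    · exact measurable_pi_apply _
    · exact measurable_const
  · exact hF.aestronglyMeasurable

lemma integral_exp_partLoglik (hz : StrictMono z) {g : Knot N → ℝ → ℝ}
    (hg0 : ∀ i b, 0 ≤ g i b) (hg1 : ∀ i, ∫ b, g i b = 1) {S : Finset (Knot N)}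
    (hS : IsPart N S) (xd : Fin n → ℝ) (Y : Fin n → ℝ) :
    ∫ β, Real.exp (partLoglik n N z xd Y S β) ∂partCondPrior N g S =
      outsideLik z xd Y *
        ∏ q ∈ consecPairs S, blockLik (g q.2) Y (dataIn xd (z q.1) (z q.2)) := by
  have hex : ∀ j : {i : Knot N // i ∈ S.erase 0}, ∃ i, Consec N S i j := fun j =>
    exists_consec_left hS.1 (Finset.mem_of_mem_erase j.2) (Finset.ne_of_mem_erase j.2)
  choose pred hpred using hex
  simp_rw [exp_partLoglik hz hS]
  rw [integral_const_mul, integral_partCondPrior hg0 hg1 S (by fun_prop)]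
  congr 1
  rw [prod_consecPairs pred hpred
    (fun i j => blockLik (g j) Y (dataIn xd (z i) (z j)))]
  unfold blockLik
  rw [← integral_fintype_prod_eq_prod (𝕜 := ℝ)
    (fun (j : {i : Knot N // i ∈ S.erase 0}) (b : ℝ) => g j.1 b *
      Real.exp (-(1 / 2) * ∑ i ∈ dataIn xd (z (pred j)) (z j), (Y i - b) ^ 2))]
  refine integral_congr_ae (ae_of_all _ fun v => ?_)
  simp only
  rw [prod_consecPairs pred hpred (fun i j =>
    Real.exp (-(1 / 2) * ∑ l ∈ dataIn xd (z i) (z j),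
      (Y l - if h : j ∈ S.erase 0 then v ⟨j, h⟩ else 0) ^ 2)), ← Finset.prod_mul_distrib]
  refine Finset.prod_congr rfl fun j _ => ?_
  simp [j.2]

lemma blockWeight_pos (hz : StrictMono z) {g : Knot N → ℝ → ℝ} (hg0 : ∀ i b, 0 ≤ g i b)
    (hg1 : ∀ i, ∫ b, g i b = 1) (xd : Fin n → ℝ) (B : ℝ) (Y : Fin n → ℝ) {i j : Knot N}
    (hij : i < j) : 0 < blockWeight z xd B g Y i j :=
  mul_pos (Real.rpow_pos_of_pos (sub_pos.2 (hz hij)) _)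
    (blockLik_pos (hg0 j) (hg1 j) _ _)

/-- The posterior probability of an event about the partition, as a ratio of sums over partitions
of products of block weights. -/
lemma partPost_eq (hz : StrictMono z) {g : Knot N → ℝ → ℝ}
    (hg0 : ∀ i b, 0 ≤ g i b) (hg1 : ∀ i, ∫ b, g i b = 1) (xd : Fin n → ℝ) (B : ℝ)
    (Y : Fin n → ℝ) (A : Finset (Knot N) → Prop) :
    partPost n N z xd B g Y (fun S _ => A S) =
      (∑ S ∈ (parts N).filter A, blockProd (blockWeight z xd B g Y) S) /
        totalMass (blockWeight z xd B g Y) := by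
  have hterm : ∀ S, IsPart N S → partWeight N z B S *
      ∫ β, Real.exp (partLoglik n N z xd Y S β) ∂partCondPrior N g S =
        outsideLik z xd Y * blockProd (blockWeight z xd B g Y) S := fun S hS => by
    rw [integral_exp_partLoglik hz hg0 hg1 hS, partWeight, if_pos hS]
    unfold blockProd blockWeight
    rw [Finset.prod_mul_distrib]
    unfold consecPairs
    ring
  have hden : ∑ S : Finset (Knot N), partWeight N z B S *
      ∫ β, Real.exp (partLoglik n N z xd Y S β) ∂partCondPrior N g S =
        outsideLik z xd Y * totalMass (blockWeight z xd B g Y) := by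
    unfold totalMass parts
    rw [Finset.mul_sum, Finset.sum_filter]
    refine Finset.sum_congr rfl fun S _ => ?_
    split_ifs with hS
    · exact hterm S hS
    · simp [partWeight, hS]
  have hnum : ∑ S : Finset (Knot N), partWeight N z B S *
      ∫ β, (if A S then (1 : ℝ) else 0) * Real.exp (partLoglik n N z xd Y S β)
        ∂partCondPrior N g S =
        outsideLik z xd Y *
          ∑ S ∈ (parts N).filter A, blockProd (blockWeight z xd B g Y) S := by
    unfold parts
    rw [Finset.mul_sum, Finset.filter_filter, Finset.sum_filter]
    refine Finset.sum_congr rfl fun S _ => ?_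
    by_cases hS : IsPart N S
    · by_cases hA : A S
      · simp only [hS, hA, and_self, if_true, one_mul]
        exact hterm S hS
      · simp [hA]
    · simp [partWeight, hS]
  unfold partPost
  rw [hden, hnum, mul_div_mul_left]
  exact (Real.exp_pos _).ne'

end Posterior

section BlockBounds

variable {n : ℕ}

/-- the mean of `Y` over `s` -/
def meanOn (Y : Fin n → ℝ) (s : Finset (Fin n)) : ℝ := (∑ i ∈ s, Y i) / s.card

/-- the sum of squared deviations of `Y` from its mean over `s` -/
def devSq (Y : Fin n → ℝ) (s : Finset (Fin n)) : ℝ := ∑ i ∈ s, (Y i - meanOn Y s) ^ 2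

/-- the number of elements of `s`, replaced by one if `s` is empty -/
def cnt (s : Finset (Fin n)) : ℝ := max (s.card : ℝ) 1

lemma one_le_cnt (s : Finset (Fin n)) : 1 ≤ cnt s := le_max_right _ _

lemma cnt_pos (s : Finset (Fin n)) : 0 < cnt s := one_pos.trans_le (one_le_cnt s)

lemma card_mul_meanOn (Y : Fin n → ℝ) (s : Finset (Fin n)) :
    (s.card : ℝ) * meanOn Y s = ∑ i ∈ s, Y i := by
  unfold meanOn
  rcases s.eq_empty_or_nonempty with rfl | h
  · simp
  · have : (s.card : ℝ) ≠ 0 := by simpa using h.ne_empty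
    field_simp

lemma sum_sq_sub (Y : Fin n → ℝ) (s : Finset (Fin n)) (c : ℝ) :
    ∑ i ∈ s, (Y i - c) ^ 2 = devSq Y s + s.card * (meanOn Y s - c) ^ 2 := by
  have h : ∀ i ∈ s, (Y i - c) ^ 2 = (Y i - meanOn Y s) ^ 2 +
      (2 * (meanOn Y s - c) * Y i + (c ^ 2 - meanOn Y s ^ 2)) := fun i _ => by ring
  rw [Finset.sum_congr rfl h, Finset.sum_add_distrib, Finset.sum_add_distrib, ← Finset.mul_sum,
    ← card_mul_meanOn Y s, Finset.sum_const, nsmul_eq_mul]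
  unfold devSq
  ring

lemma blockLik_le {g : ℝ → ℝ} {c₁ : ℝ} (hg0 : ∀ b, 0 ≤ g b) (hgc : ∀ b, g b ≤ c₁)
    (hg1 : ∫ b, g b = 1) (Y : Fin n → ℝ) (s : Finset (Fin n)) :
    blockLik g Y s ≤
      max 1 (c₁ * √(2 * Real.pi)) / √(cnt s) * Real.exp (-(1 / 2) * devSq Y s) := by
  rcases s.eq_empty_or_nonempty with rfl | hs
  · simp [blockLik, devSq, cnt, hg1]
  have hcard : (1 : ℝ) ≤ s.card := by exact_mod_cast hs.card_pos
  have hcnt : cnt s = s.card := max_eq_left hcard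
  have hc1 : 0 ≤ c₁ := (hg0 0).trans (hgc 0)
  have hGi : Integrable fun b : ℝ => Real.exp (-((s.card : ℝ) / 2) * (b - meanOn Y s) ^ 2) :=
    (integrable_exp_neg_mul_sq (by positivity)).comp_sub_right _
  calc blockLik g Y s
      ≤ ∫ b, c₁ * Real.exp (-(1 / 2) * devSq Y s) *
          Real.exp (-((s.card : ℝ) / 2) * (b - meanOn Y s) ^ 2) := by
        refine integral_mono (integrable_blockLik (integrable_of_integral_eq_one hg1) Y s)
          (hGi.const_mul _) fun b => ?_
        simp only
        rw [sum_sq_sub, mul_assoc, ← Real.exp_add]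
        refine mul_le_mul (hgc b) (le_of_eq ?_) (Real.exp_pos _).le hc1
        congr 1
        ring
    _ = c₁ * √(2 * Real.pi) / √(cnt s) * Real.exp (-(1 / 2) * devSq Y s) := by
        rw [integral_const_mul,
          integral_sub_right_eq_self (fun b : ℝ => Real.exp (-((s.card : ℝ) / 2) * b ^ 2)),
          integral_gaussian, hcnt,
          show Real.pi / ((s.card : ℝ) / 2) = 2 * Real.pi / s.card by field_simp,
          Real.sqrt_div (by positivity)]
        ring
    _ ≤ _ := by
        gcongr
        exact le_max_right _ _

lemma le_blockLik {g : ℝ → ℝ} {c₀ B₀ τ c : ℝ} (hg0 : ∀ b, 0 ≤ g b)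
    (hgc : ∀ b, |b| ≤ B₀ → c₀ ≤ g b) (hτ : 0 < τ) (hc : |c| ≤ B₀ - τ)
    (hg1 : ∫ b, g b = 1) (Y : Fin n → ℝ) (s : Finset (Fin n)) :
    c₀ * Real.exp (-(1 / 2)) * min 1 τ / √(cnt s) *
      Real.exp (-(1 / 2) * ∑ i ∈ s, (Y i - c) ^ 2) ≤ blockLik g Y s := by
  set ℓ := min 1 τ / √(cnt s) with hℓ
  have hs1 : 1 ≤ √(cnt s) := Real.one_le_sqrt.2 (one_le_cnt s)
  have hmin : 0 < min 1 τ := lt_min one_pos hτ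
  have hℓ0 : 0 < ℓ := div_pos hmin (one_pos.trans_le hs1)
  have hℓτ : ℓ ≤ τ := (div_le_self hmin.le hs1).trans (min_le_right _ _)
  have hℓs : s.card * ℓ ^ 2 ≤ 1 := by
    rw [hℓ, div_pow, Real.sq_sqrt (cnt_pos s).le, mul_div_assoc', div_le_one (cnt_pos s)]
    have h1 : min 1 τ ^ 2 ≤ 1 := pow_le_one₀ hmin.le (min_le_left _ _)
    calc (s.card : ℝ) * min 1 τ ^ 2 ≤ s.card * 1 := by gcongr
      _ ≤ cnt s := by rw [mul_one]; exact le_max_left _ _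
  obtain ⟨a, hau, hab⟩ : ∃ a, (∀ b ∈ Set.Icc a (a + ℓ), |b - c| ≤ ℓ) ∧
      ∀ b ∈ Set.Icc a (a + ℓ), (b - c) * (meanOn Y s - c) ≥ 0 := by
    rcases le_total c (meanOn Y s) with h | h
    · refine ⟨c, fun b hb => abs_le.2 ⟨?_, ?_⟩, fun b hb => mul_nonneg ?_ ?_⟩ <;>
        linarith [hb.1, hb.2]
    · refine ⟨c - ℓ, fun b hb => abs_le.2 ⟨?_, ?_⟩,
        fun b hb => mul_nonneg_of_nonpos_of_nonpos ?_ ?_⟩ <;> linarith [hb.1, hb.2]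
  have hint := integrable_blockLik (integrable_of_integral_eq_one hg1) Y s
  calc c₀ * Real.exp (-(1 / 2)) * min 1 τ / √(cnt s) *
        Real.exp (-(1 / 2) * ∑ i ∈ s, (Y i - c) ^ 2)
      = ∫ _ in Set.Icc a (a + ℓ), c₀ * (Real.exp (-(1 / 2)) *
          Real.exp (-(1 / 2) * ∑ i ∈ s, (Y i - c) ^ 2)) := by
        rw [setIntegral_const, Measure.real, Real.volume_Icc, add_sub_cancel_left,
          ENNReal.toReal_ofReal hℓ0.le, smul_eq_mul, hℓ]
        ring
    _ ≤ ∫ b in Set.Icc a (a + ℓ), g b * Real.exp (-(1 / 2) * ∑ i ∈ s, (Y i - b) ^ 2) := by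
        refine setIntegral_mono_on (integrable_const _) hint.integrableOn measurableSet_Icc
          fun b hb => ?_
        have hbc := hau b hb
        refine mul_le_mul (hgc b ?_) ?_ (by positivity) (hg0 b)
        · calc |b| = |c + (b - c)| := by ring_nf
            _ ≤ |c| + |b - c| := abs_add_le _ _
            _ ≤ B₀ := by linarith
        · rw [← Real.exp_add]
          refine Real.exp_le_exp.2 ?_
          rw [sum_sq_sub Y s c, sum_sq_sub Y s b]
          have h1 : (b - c) ^ 2 ≤ ℓ ^ 2 := sq_le_sq' (by linarith [(abs_le.1 hbc).1])
            (abs_le.1 hbc).2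
          have h2 : (s.card : ℝ) * (b - c) ^ 2 ≤ 1 :=
            (mul_le_mul_of_nonneg_left h1 (Nat.cast_nonneg _)).trans hℓs
          have h3 : 0 ≤ (s.card : ℝ) * ((b - c) * (meanOn Y s - c)) :=
            mul_nonneg (Nat.cast_nonneg _) (hab b hb)
          nlinarith
    _ ≤ blockLik g Y s :=
        setIntegral_le_integral hint
          (ae_of_all _ fun b => mul_nonneg (hg0 b) (Real.exp_pos _).le)

/-- Merging two blocks of observations. -/
lemma blockLik_mul_le_merge {g g' : ℝ → ℝ} {c₀ c₁ B₀ τ c : ℝ} (hg0 : ∀ b, 0 ≤ g b)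
    (hgc : ∀ b, g b ≤ c₁) (hg1 : ∫ b, g b = 1) (hg0' : ∀ b, 0 ≤ g' b)
    (hgc' : ∀ b, g' b ≤ c₁) (hgl' : ∀ b, |b| ≤ B₀ → c₀ ≤ g' b) (hg1' : ∫ b, g' b = 1)
    (hc₀ : 0 < c₀) (hτ : 0 < τ) (hc : |c| ≤ B₀ - τ)
    (Y : Fin n → ℝ) {s s' : Finset (Fin n)} (hd : Disjoint s s') :
    blockLik g Y s * blockLik g' Y s' ≤
      max 1 (c₁ * √(2 * Real.pi)) ^ 2 * √2 / (c₀ * Real.exp (-(1 / 2)) * min 1 τ) *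
        Real.exp (1 / 2 * (s.card * (meanOn Y s - c) ^ 2 + s'.card * (meanOn Y s' - c) ^ 2)) *
        blockLik g' Y (s ∪ s') := by
  have hu := blockLik_le hg0 hgc hg1 Y s
  have hu' := blockLik_le hg0' hgc' hg1' Y s'
  have hl := le_blockLik hg0' hgl' hτ hc hg1' Y (s ∪ s')
  rw [Finset.sum_union hd, sum_sq_sub, sum_sq_sub] at hl
  set K := max 1 (c₁ * √(2 * Real.pi))
  set l := c₀ * Real.exp (-(1 / 2)) * min 1 τ
  have hK : 0 < K := one_pos.trans_le (le_max_left _ _)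
  have hlpos : 0 < l := by
    have : 0 < min 1 τ := lt_min one_pos hτ
    positivity
  have hcnt : √(cnt (s ∪ s')) ≤ √2 * √(cnt s) * √(cnt s') := by
    rw [← Real.sqrt_mul (by norm_num), ← Real.sqrt_mul (by linarith [cnt_pos s])]
    refine Real.sqrt_le_sqrt (max_le ?_ ?_)
    · rw [Finset.card_union_of_disjoint hd]
      push_cast
      nlinarith [one_le_cnt s, one_le_cnt s', le_max_left (s.card : ℝ) 1,
        le_max_left (s'.card : ℝ) 1, show cnt s = max (s.card : ℝ) 1 from rfl,
        show cnt s' = max (s'.card : ℝ) 1 from rfl]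
    · nlinarith [one_le_cnt s, one_le_cnt s']
  have hpos := Real.sqrt_pos.2 (cnt_pos s)
  have hpos' := Real.sqrt_pos.2 (cnt_pos s')
  have hposU := Real.sqrt_pos.2 (cnt_pos (s ∪ s'))
  set E := Real.exp (1 / 2 * (s.card * (meanOn Y s - c) ^ 2 + s'.card * (meanOn Y s' - c) ^ 2))
    with hE
  calc blockLik g Y s * blockLik g' Y s'
      ≤ (K / √(cnt s) * Real.exp (-(1 / 2) * devSq Y s)) *
          (K / √(cnt s') * Real.exp (-(1 / 2) * devSq Y s')) :=
        mul_le_mul hu hu' (blockLik_pos hg0' hg1' _ _).le (by positivity)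
    _ = K ^ 2 / (√(cnt s) * √(cnt s')) * Real.exp (-(1 / 2) * (devSq Y s + devSq Y s')) := by
        rw [mul_add, Real.exp_add]
        field_simp
    _ ≤ K ^ 2 * √2 / √(cnt (s ∪ s')) * Real.exp (-(1 / 2) * (devSq Y s + devSq Y s')) := by
        gcongr ?_ * _
        rw [div_le_div_iff₀ (by positivity) hposU]
        calc K ^ 2 * √(cnt (s ∪ s')) ≤ K ^ 2 * (√2 * √(cnt s) * √(cnt s')) := by gcongr
          _ = _ := by ring
    _ = K ^ 2 * √2 / l * E * (l / √(cnt (s ∪ s')) *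
          Real.exp (-(1 / 2) * (devSq Y s + s.card * (meanOn Y s - c) ^ 2 +
            (devSq Y s' + s'.card * (meanOn Y s' - c) ^ 2)))) := by
        have : Real.exp (-(1 / 2) * (devSq Y s + devSq Y s')) = E *
          Real.exp (-(1 / 2) * (devSq Y s + s.card * (meanOn Y s - c) ^ 2 +
            (devSq Y s' + s'.card * (meanOn Y s' - c) ^ 2))) := by
          rw [hE, ← Real.exp_add]
          congr 1
          ring
        rw [this]
        field_simp
    _ ≤ _ := by gcongr

/-- Moving the observations `s₁` from the block `s₁ ∪ s₂` to the block `s`. -/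
lemma blockLik_mul_le_move {g g' g'' : ℝ → ℝ} {c₀ c₁ B₀ τ c : ℝ} (hg0 : ∀ b, 0 ≤ g b)
    (hgc : ∀ b, g b ≤ c₁) (hg1 : ∫ b, g b = 1) (hg0' : ∀ b, 0 ≤ g' b)
    (hgc' : ∀ b, g' b ≤ c₁) (hgl' : ∀ b, |b| ≤ B₀ → c₀ ≤ g' b) (hg1' : ∫ b, g' b = 1)
    (hg0'' : ∀ b, 0 ≤ g'' b) (hgl'' : ∀ b, |b| ≤ B₀ → c₀ ≤ g'' b) (hg1'' : ∫ b, g'' b = 1)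
    (hc₀ : 0 < c₀) (hτ : 0 < τ) (hc : |c| ≤ B₀ - τ)
    (Y : Fin n → ℝ) {s s₁ s₂ : Finset (Fin n)} (hd : Disjoint s s₁) (hd' : Disjoint s₁ s₂)
    (hd₀ : |meanOn Y (s₁ ∪ s₂)| ≤ B₀ - τ) (hn : 1 ≤ n) :
    blockLik g Y s * blockLik g' Y (s₁ ∪ s₂) ≤
      max 1 (c₁ * √(2 * Real.pi)) ^ 2 / (c₀ * Real.exp (-(1 / 2)) * min 1 τ) ^ 2 * n *
        Real.exp (1 / 2 * (s.card * (meanOn Y s - c) ^ 2 +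
          s₁.card * ((meanOn Y s₁ - c) ^ 2 - (meanOn Y s₁ - meanOn Y (s₁ ∪ s₂)) ^ 2))) *
        (blockLik g'' Y (s ∪ s₁) * blockLik g' Y s₂) := by
  have hu := blockLik_le hg0 hgc hg1 Y s
  have hu' := blockLik_le hg0' hgc' hg1' Y (s₁ ∪ s₂)
  have hl := le_blockLik hg0'' hgl'' hτ hc hg1'' Y (s ∪ s₁)
  have hl' := le_blockLik hg0' hgl' hτ hd₀ hg1' Y s₂
  set d := meanOn Y (s₁ ∪ s₂) with hdd
  have hdev : devSq Y (s₁ ∪ s₂) = devSq Y s₁ + s₁.card * (meanOn Y s₁ - d) ^ 2 +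
      ∑ i ∈ s₂, (Y i - d) ^ 2 := by
    rw [devSq, ← hdd, Finset.sum_union hd', sum_sq_sub Y s₁]
  rw [Finset.sum_union hd, sum_sq_sub, sum_sq_sub Y s₁] at hl
  set K := max 1 (c₁ * √(2 * Real.pi))
  set l := c₀ * Real.exp (-(1 / 2)) * min 1 τ
  have hK : 0 < K := one_pos.trans_le (le_max_left _ _)
  have hlpos : 0 < l := by
    have : 0 < min 1 τ := lt_min one_pos hτ
    positivity
  have hle : ∀ u : Finset (Fin n), √(cnt u) ≤ √n := fun u => by
    refine Real.sqrt_le_sqrt (max_le ?_ (by exact_mod_cast hn))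
    exact_mod_cast (Finset.card_le_univ u).trans_eq (Fintype.card_fin n)
  have hs1 : ∀ u : Finset (Fin n), 1 ≤ √(cnt u) := fun u => Real.one_le_sqrt.2 (one_le_cnt u)
  have hp1 := one_pos.trans_le (hs1 (s ∪ s₁))
  have hp2 := one_pos.trans_le (hs1 s₂)
  set E := Real.exp (1 / 2 * (s.card * (meanOn Y s - c) ^ 2 +
          s₁.card * ((meanOn Y s₁ - c) ^ 2 - (meanOn Y s₁ - d) ^ 2))) with hE
  set D := Real.exp (-(1 / 2) * devSq Y s) * Real.exp (-(1 / 2) * devSq Y (s₁ ∪ s₂)) with hD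
  have hDE : D = E * (Real.exp (-(1 / 2) * (devSq Y s + s.card * (meanOn Y s - c) ^ 2 +
      (devSq Y s₁ + s₁.card * (meanOn Y s₁ - c) ^ 2))) *
        Real.exp (-(1 / 2) * ∑ i ∈ s₂, (Y i - d) ^ 2)) := by
    rw [hE, hD, hdev, ← Real.exp_add, ← Real.exp_add, ← Real.exp_add]
    congr 1
    ring
  calc blockLik g Y s * blockLik g' Y (s₁ ∪ s₂)
      ≤ (K / √(cnt s) * Real.exp (-(1 / 2) * devSq Y s)) *
          (K / √(cnt (s₁ ∪ s₂)) * Real.exp (-(1 / 2) * devSq Y (s₁ ∪ s₂))) :=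
        mul_le_mul hu hu' (blockLik_pos hg0' hg1' _ _).le (by positivity)
    _ ≤ (K * Real.exp (-(1 / 2) * devSq Y s)) *
          (K * Real.exp (-(1 / 2) * devSq Y (s₁ ∪ s₂))) := by
        gcongr
        · exact div_le_self hK.le (hs1 _)
        · exact div_le_self hK.le (hs1 _)
    _ = K ^ 2 * D := by rw [hD]; ring
    _ ≤ K ^ 2 * (n / (√(cnt (s ∪ s₁)) * √(cnt s₂))) * D := by
        have hD0 : 0 ≤ D := by positivity
        refine mul_le_mul_of_nonneg_right (le_mul_of_one_le_right (by positivity) ?_) hD0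
        rw [one_le_div (by positivity)]
        calc √(cnt (s ∪ s₁)) * √(cnt s₂) ≤ √n * √n :=
              mul_le_mul (hle _) (hle _) (by positivity) (by positivity)
          _ = n := Real.mul_self_sqrt (Nat.cast_nonneg _)
    _ = K ^ 2 / l ^ 2 * n * E * ((l / √(cnt (s ∪ s₁)) *
          Real.exp (-(1 / 2) * (devSq Y s + s.card * (meanOn Y s - c) ^ 2 +
            (devSq Y s₁ + s₁.card * (meanOn Y s₁ - c) ^ 2)))) *
          (l / √(cnt s₂) * Real.exp (-(1 / 2) * ∑ i ∈ s₂, (Y i - d) ^ 2))) := by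
        rw [hDE]
        field_simp
    _ ≤ _ := by
        gcongr
        exact (blockLik_pos hg0'' hg1'' _ _).le

end BlockBounds

section GaussianMoments

instance : IsProbabilityMeasure stdGaussian := by unfold stdGaussian; infer_instance

instance (n : ℕ) : IsProbabilityMeasure (regNoise n) := by unfold regNoise; infer_instance

lemma integral_exp_sum_regNoise {n : ℕ} (c : Fin n → ℝ) :
    Integrable (fun ε : Fin n → ℝ => Real.exp (∑ i, c i * ε i)) (regNoise n) ∧
      ∫ ε, Real.exp (∑ i, c i * ε i) ∂regNoise n = Real.exp (∑ i, c i ^ 2 / 2) := by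
  have h1 : ∀ i, Integrable (fun y : ℝ => Real.exp (c i * y)) stdGaussian := fun i =>
    integrable_exp_mul_gaussianReal (c i)
  simp only [Real.exp_sum]
  refine ⟨Integrable.fintype_prod (μ := fun _ : Fin n => stdGaussian)
    (f := fun i y => Real.exp (c i * y)) h1, ?_⟩
  rw [regNoise, integral_fintype_prod_eq_prod (fun i (y : ℝ) => Real.exp (c i * y))]
  refine Finset.prod_congr rfl fun i _ => ?_
  have := congrFun (mgf_id_gaussianReal (μ := 0) (v := 1)) (c i)
  simpa [mgf, stdGaussian] using this

lemma lintegral_exp_sum_regNoise {n : ℕ} (c : Fin n → ℝ) :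
    ∫⁻ ε, ENNReal.ofReal (Real.exp (∑ i, c i * ε i)) ∂regNoise n =
      ENNReal.ofReal (Real.exp (∑ i, c i ^ 2 / 2)) := by
  rw [← (integral_exp_sum_regNoise c).2, ofReal_integral_eq_lintegral_ofReal
    (integral_exp_sum_regNoise c).1 (ae_of_all _ fun _ => (Real.exp_pos _).le)]

lemma integrable_exp_sq_stdGaussian {κ : ℝ} (hκ : κ < 1) :
    Integrable (fun y : ℝ => Real.exp (κ / 2 * y ^ 2)) stdGaussian := by
  rw [stdGaussian, gaussianReal_of_var_ne_zero _ one_ne_zero,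
    integrable_withDensity_iff_integrable_smul₀' (measurable_gaussianPDF _ _).aemeasurable
      (ae_of_all _ fun _ => ENNReal.ofReal_lt_top)]
  have h := (integrable_exp_neg_mul_sq (b := (1 - κ) / 2) (by linarith)).const_mul
    ((√(2 * Real.pi * (1 : ℝ≥0)))⁻¹)
  refine h.congr (ae_of_all _ fun y => ?_)
  simp only [gaussianPDF, ENNReal.toReal_ofReal (gaussianPDFReal_nonneg _ _ _), smul_eq_mul]
  rw [gaussianPDFReal, mul_assoc _ (Real.exp _) (Real.exp _), ← Real.exp_add]
  congr 2
  simp only [NNReal.coe_one, sub_zero]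
  ring

/-- quadratic exponential moments of two orthogonal linear statistics of the noise -/
lemma exists_integral_exp_sq_regNoise_le {κ : ℝ} (hκ₀ : 0 ≤ κ) (hκ : κ < 1) :
    ∃ C : ℝ, 0 < C ∧ ∀ (n : ℕ) (a : Fin 2 → Fin n → ℝ),
      (∀ ξ : Fin 2 → ℝ, ∑ i, (∑ k, ξ k * a k i) ^ 2 ≤ ∑ k, ξ k ^ 2) →
      Integrable (fun ε : Fin n → ℝ =>
        Real.exp (κ / 2 * ∑ k, (∑ i, a k i * ε i) ^ 2)) (regNoise n) ∧
      ∫ ε, Real.exp (κ / 2 * ∑ k, (∑ i, a k i * ε i) ^ 2) ∂regNoise n ≤ C := by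
  have hi : Integrable (fun ξ : Fin 2 → ℝ => Real.exp (κ / 2 * ∑ k, ξ k ^ 2)) (regNoise 2) := by
    simp only [Finset.mul_sum, Real.exp_sum]
    exact Integrable.fintype_prod (μ := fun _ : Fin 2 => stdGaussian)
      (f := fun _ y => Real.exp (κ / 2 * y ^ 2)) fun _ => integrable_exp_sq_stdGaussian hκ
  refine ⟨∫ ξ, Real.exp (κ / 2 * ∑ k, ξ k ^ 2) ∂regNoise 2, integral_exp_pos hi,
    fun n a ha => ?_⟩
  have key : ∫⁻ ε, ENNReal.ofReal (Real.exp (κ / 2 * ∑ k, (∑ i, a k i * ε i) ^ 2)) ∂regNoise n ≤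
      ENNReal.ofReal (∫ ξ, Real.exp (κ / 2 * ∑ k, ξ k ^ 2) ∂regNoise 2) := by
    rw [ofReal_integral_eq_lintegral_ofReal hi (ae_of_all _ fun _ => (Real.exp_pos _).le)]
    have h1 : ∀ ε : Fin n → ℝ,
        ENNReal.ofReal (Real.exp (κ / 2 * ∑ k, (∑ i, a k i * ε i) ^ 2)) =
          ∫⁻ ξ, ENNReal.ofReal (Real.exp (∑ k, (√κ * ∑ i, a k i * ε i) * ξ k)) ∂regNoise 2 := by
      intro ε
      rw [lintegral_exp_sum_regNoise]
      congr 2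
      rw [Finset.mul_sum]
      refine Finset.sum_congr rfl fun k _ => ?_
      rw [mul_pow, Real.sq_sqrt hκ₀]
      ring
    have h2 : ∀ ξ : Fin 2 → ℝ,
        ∫⁻ ε, ENNReal.ofReal (Real.exp (∑ k, (√κ * ∑ i, a k i * ε i) * ξ k)) ∂regNoise n ≤
          ENNReal.ofReal (Real.exp (κ / 2 * ∑ k, ξ k ^ 2)) := by
      intro ξ
      have : ∀ ε : Fin n → ℝ, ∑ k, (√κ * ∑ i, a k i * ε i) * ξ k =
          ∑ i, (√κ * ∑ k, ξ k * a k i) * ε i := by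
        intro ε
        simp only [Finset.mul_sum, Finset.sum_mul]
        rw [Finset.sum_comm]
        exact Finset.sum_congr rfl fun i _ => Finset.sum_congr rfl fun k _ => by ring
      simp only [this]
      rw [lintegral_exp_sum_regNoise]
      refine ENNReal.ofReal_le_ofReal (Real.exp_le_exp.2 ?_)
      simp only [mul_pow, Real.sq_sqrt hκ₀]
      rw [← Finset.sum_div, ← Finset.mul_sum]
      nlinarith [ha ξ]
    simp only [h1]
    rw [lintegral_lintegral_swap]
    · exact lintegral_mono h2
    · exact (Measurable.aemeasurable (by fun_prop))
  have hm : AEStronglyMeasurable (fun ε : Fin n → ℝ =>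
      Real.exp (κ / 2 * ∑ k, (∑ i, a k i * ε i) ^ 2)) (regNoise n) :=
    (Measurable.aestronglyMeasurable (by fun_prop))
  have hint : Integrable (fun ε : Fin n → ℝ =>
      Real.exp (κ / 2 * ∑ k, (∑ i, a k i * ε i) ^ 2)) (regNoise n) := by
    refine ⟨hm, ?_⟩
    rw [hasFiniteIntegral_iff_ofReal (ae_of_all _ fun _ => (Real.exp_pos _).le)]
    exact key.trans_lt ENNReal.ofReal_lt_top
  refine ⟨hint, ?_⟩
  rwa [← ofReal_integral_eq_lintegral_ofReal hint (ae_of_all _ fun _ => (Real.exp_pos _).le),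
    ENNReal.ofReal_le_ofReal_iff (integral_exp_pos hi).le] at key

/-- the squared normalised sum of the noise over `s` -/
def noiseSq {n : ℕ} (ε : Fin n → ℝ) (s : Finset (Fin n)) : ℝ := s.card * meanOn ε s ^ 2

lemma noiseSq_empty {n : ℕ} (ε : Fin n → ℝ) : noiseSq ε ∅ = 0 := by simp [noiseSq]

lemma noiseSq_eq_sq {n : ℕ} (ε : Fin n → ℝ) (s : Finset (Fin n)) :
    noiseSq ε s = (∑ i, (if i ∈ s then (√s.card)⁻¹ else 0) * ε i) ^ 2 := by
  simp only [ite_mul, zero_mul, Finset.sum_ite_mem, Finset.univ_inter]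
  rw [← Finset.mul_sum, noiseSq, meanOn, mul_pow, inv_pow, Real.sq_sqrt (Nat.cast_nonneg _)]
  rcases eq_or_ne (s.card : ℝ) 0 with h | h
  · simp [h]
  · field_simp

lemma exists_integral_exp_noiseSq_le {κ : ℝ} (hκ₀ : 0 ≤ κ) (hκ : κ < 1) :
    ∃ C : ℝ, 0 < C ∧ ∀ (n : ℕ) (s s' : Finset (Fin n)), Disjoint s s' →
      Integrable (fun ε : Fin n → ℝ =>
        Real.exp (κ / 2 * (noiseSq ε s + noiseSq ε s'))) (regNoise n) ∧
      ∫ ε, Real.exp (κ / 2 * (noiseSq ε s + noiseSq ε s')) ∂regNoise n ≤ C := by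
  obtain ⟨C, hC, h⟩ := exists_integral_exp_sq_regNoise_le hκ₀ hκ
  refine ⟨C, hC, fun n s s' hd => ?_⟩
  have hself : ∀ u : Finset (Fin n), (u.card : ℝ) * ((√u.card)⁻¹) ^ 2 ≤ 1 := by
    intro u
    rw [inv_pow, Real.sq_sqrt (Nat.cast_nonneg _)]
    exact mul_inv_le_one
  have := h n ![fun i => if i ∈ s then (√s.card)⁻¹ else 0,
    fun i => if i ∈ s' then (√s'.card)⁻¹ else 0] ?_
  · simpa only [Fin.sum_univ_two, Matrix.cons_val_zero, Matrix.cons_val_one,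
      ← noiseSq_eq_sq] using this
  · intro ξ
    simp only [Fin.sum_univ_two, Matrix.cons_val_zero, Matrix.cons_val_one]
    have hsum : ∀ i, (ξ 0 * (if i ∈ s then (√s.card)⁻¹ else 0) +
        ξ 1 * (if i ∈ s' then (√s'.card)⁻¹ else 0)) ^ 2 =
        (if i ∈ s then ξ 0 ^ 2 * ((√s.card)⁻¹) ^ 2 else 0) +
          (if i ∈ s' then ξ 1 ^ 2 * ((√s'.card)⁻¹) ^ 2 else 0) := by
      intro i
      by_cases h1 : i ∈ s
      · have h2 : i ∉ s' := Finset.disjoint_left.1 hd h1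
        simp only [h1, h2, if_true, if_false]
        ring
      · simp only [h1, if_false]
        split_ifs <;> ring
    simp only [hsum, Finset.sum_add_distrib, Finset.sum_ite_mem, Finset.univ_inter,
      Finset.sum_const, nsmul_eq_mul]
    nlinarith [mul_le_mul_of_nonneg_left (hself s) (sq_nonneg (ξ 0)),
      mul_le_mul_of_nonneg_left (hself s') (sq_nonneg (ξ 1))]

end GaussianMoments

section WeightBounds

variable {n N : ℕ}

lemma meanOn_add (F ε : Fin n → ℝ) (s : Finset (Fin n)) :
    meanOn (fun l => F l + ε l) s = meanOn F s + meanOn ε s := by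
  simp only [meanOn, Finset.sum_add_distrib, add_div]

lemma abs_meanOn_sub_le {F : Fin n → ℝ} {s : Finset (Fin n)} (hs : s.Nonempty) {c w : ℝ}
    (h : ∀ l ∈ s, |F l - c| ≤ w) : |meanOn F s - c| ≤ w := by
  have hc : (0 : ℝ) < s.card := by exact_mod_cast hs.card_pos
  have : meanOn F s - c = (∑ l ∈ s, (F l - c)) / s.card := by
    rw [meanOn, Finset.sum_sub_distrib, Finset.sum_const, nsmul_eq_mul]
    field_simp
  rw [this, abs_div, abs_of_pos hc, div_le_iff₀ hc]
  calc |∑ l ∈ s, (F l - c)| ≤ ∑ l ∈ s, |F l - c| := Finset.abs_sum_le_sum_abs _ _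
    _ ≤ ∑ _l ∈ s, w := Finset.sum_le_sum h
    _ = w * s.card := by rw [Finset.sum_const, nsmul_eq_mul, mul_comm]

lemma abs_meanOn_add_sub_le {F ε : Fin n → ℝ} {s : Finset (Fin n)} (hs : s.Nonempty) {c w v : ℝ}
    (h : ∀ l ∈ s, |F l - c| ≤ w) (hε : |meanOn ε s| ≤ v) :
    |meanOn (fun l => F l + ε l) s - c| ≤ w + v := by
  rw [meanOn_add, add_sub_right_comm]
  exact (abs_add_le _ _).trans (add_le_add (abs_meanOn_sub_le hs h) hε)

/-- bias-variance bound with slack `s` -/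
lemma card_mul_sq_le {F ε : Fin n → ℝ} {u : Finset (Fin n)} {c w s : ℝ} (hs : 0 < s)
    (h : ∀ l ∈ u, |F l - c| ≤ w) :
    u.card * (meanOn (fun l => F l + ε l) u - c) ^ 2 ≤
      (1 + s) * noiseSq ε u + (1 + 1 / s) * (u.card * w ^ 2) := by
  rcases u.eq_empty_or_nonempty with rfl | hu
  · simp [noiseSq]
  have h1 := abs_meanOn_sub_le hu h
  have h2 : (meanOn F u - c) ^ 2 ≤ w ^ 2 := sq_le_sq' (abs_le.1 h1).1 (abs_le.1 h1).2
  rw [meanOn_add, noiseSq]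
  set a := meanOn F u - c
  set b := meanOn ε u
  have h3 : (meanOn F u + b - c) ^ 2 ≤ (1 + s) * b ^ 2 + (1 + 1 / s) * a ^ 2 := by
    have : (1 + s) * b ^ 2 + (1 + 1 / s) * a ^ 2 - (a + b) ^ 2 = (s * b - a) ^ 2 / s := by
      field_simp
      ring
    have h4 : 0 ≤ (s * b - a) ^ 2 / s := by positivity
    have h5 : meanOn F u + b - c = a + b := by simp only [a]; ring
    rw [h5]; linarith
  calc (u.card : ℝ) * (meanOn F u + b - c) ^ 2
      ≤ u.card * ((1 + s) * b ^ 2 + (1 + 1 / s) * w ^ 2) := by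
        gcongr
        exact h3.trans (by gcongr)
    _ = _ := by ring

lemma dataIn_union {z : Knot N → ℝ} (hz : StrictMono z) (xd : Fin n → ℝ) {i j k : Knot N}
    (hij : i < j) (hjk : j < k) :
    dataIn xd (z i) (z j) ∪ dataIn xd (z j) (z k) = dataIn xd (z i) (z k) := by
  rw [dataIn, dataIn, dataIn, ← Finset.filter_or]
  simp only [← Set.mem_union, Set.Ioc_union_Ioc_eq_Ioc (hz hij).le (hz hjk).le]

lemma disjoint_dataIn (xd : Fin n → ℝ) (a b c : ℝ) :
    Disjoint (dataIn xd a b) (dataIn xd b c) := by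
  rw [Finset.disjoint_left]
  intro l h h'
  simp only [dataIn, Finset.mem_filter, Finset.mem_univ, true_and, Set.mem_Ioc] at h h'
  linarith [h.2, h'.1]

/-- the constant in the bound for merging two blocks -/
def mergeConst (c₀ c₁ τ : ℝ) : ℝ :=
  max 1 (c₁ * √(2 * Real.pi)) ^ 2 * √2 / (c₀ * Real.exp (-(1 / 2)) * min 1 τ)

/-- the constant in the bound for moving a knot -/
def moveConst (c₀ c₁ τ : ℝ) : ℝ :=
  max 1 (c₁ * √(2 * Real.pi)) ^ 2 / (c₀ * Real.exp (-(1 / 2)) * min 1 τ) ^ 2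

lemma mergeConst_nonneg {c₀ c₁ τ : ℝ} (hc₀ : 0 < c₀) (hτ : 0 < τ) : 0 ≤ mergeConst c₀ c₁ τ := by
  have : 0 < min 1 τ := lt_min one_pos hτ
  unfold mergeConst; positivity

lemma moveConst_nonneg {c₀ c₁ τ : ℝ} : 0 ≤ moveConst c₀ c₁ τ := by
  unfold moveConst; positivity

lemma rpow_mul_rpow_le_merge {a b B : ℝ} (ha : 0 < a) (hb : 0 < b) (hB : 0 ≤ B) :
    a ^ B * b ^ B ≤ a ^ B * (a + b) ^ B := by
  have := Real.rpow_le_rpow hb.le (by linarith : b ≤ a + b) hB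
  gcongr

lemma rpow_mul_rpow_le_move {a b b' B : ℝ} (ha : 0 < a) (hb : 0 < b) (hbb : b ≤ b') (hB : 0 ≤ B) :
    a ^ B * (b + b') ^ B ≤ 2 ^ B * ((a + b) ^ B * b' ^ B) := by
  rw [← Real.mul_rpow ha.le (by linarith), ← Real.mul_rpow (by linarith) (by linarith),
    ← Real.mul_rpow (by norm_num) (by nlinarith)]
  exact Real.rpow_le_rpow (by nlinarith) (by nlinarith) hB

variable {z : Knot N → ℝ} {g : Knot N → ℝ → ℝ} {c₀ c₁ B₀ τ B : ℝ}

lemma blockWeight_mul_le_merge (hz : StrictMono z) (hg : GoodDens N g c₀ c₁ B₀) (hc₀ : 0 < c₀)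
    (hτ : 0 < τ) (hB : 0 ≤ B) {c h E : ℝ} (hc : |c| ≤ B₀ - τ) (xd : Fin n → ℝ) (Y : Fin n → ℝ)
    {i j k : Knot N} (hij : i < j) (hjk : j < k) (hh : z j - z i ≤ h)
    (hE : (dataIn xd (z i) (z j)).card * (meanOn Y (dataIn xd (z i) (z j)) - c) ^ 2 +
      (dataIn xd (z j) (z k)).card * (meanOn Y (dataIn xd (z j) (z k)) - c) ^ 2 ≤ E) :
    blockWeight z xd B g Y i j * blockWeight z xd B g Y j k ≤
      mergeConst c₀ c₁ τ * h ^ B * Real.exp (1 / 2 * E) * blockWeight z xd B g Y i k := by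
  have h1 := blockLik_mul_le_merge (hg j).2.1 (hg j).2.2.1 (hg j).2.2.2 (hg k).2.1 (hg k).2.2.1
    (hg k).1 (hg k).2.2.2 hc₀ hτ hc Y (disjoint_dataIn xd (z i) (z j) (z k))
  rw [dataIn_union hz xd hij hjk] at h1
  have hzij := sub_pos.2 (hz hij)
  have hzjk := sub_pos.2 (hz hjk)
  have h2 : (z j - z i) ^ B * (z k - z j) ^ B ≤ h ^ B * (z k - z i) ^ B := by
    have e : z k - z i = (z j - z i) + (z k - z j) := by ring
    rw [e]
    refine (rpow_mul_rpow_le_merge hzij hzjk hB).trans ?_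
    have : 0 ≤ (z j - z i + (z k - z j)) ^ B := Real.rpow_nonneg (by linarith) _
    gcongr
  have hL := (blockLik_pos (hg k).2.1 (hg k).2.2.2 Y (dataIn xd (z i) (z k))).le
  have hC := mergeConst_nonneg (c₁ := c₁) hc₀ hτ
  have hhB : 0 ≤ h ^ B * (z k - z i) ^ B :=
    mul_nonneg (Real.rpow_nonneg (by linarith) _) (Real.rpow_nonneg (by linarith) _)
  simp only [blockWeight]
  calc (z j - z i) ^ B * blockLik (g j) Y (dataIn xd (z i) (z j)) *
        ((z k - z j) ^ B * blockLik (g k) Y (dataIn xd (z j) (z k)))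
      = (z j - z i) ^ B * (z k - z j) ^ B * (blockLik (g j) Y (dataIn xd (z i) (z j)) *
        blockLik (g k) Y (dataIn xd (z j) (z k))) := by ring
    _ ≤ h ^ B * (z k - z i) ^ B * (mergeConst c₀ c₁ τ * Real.exp (1 / 2 * E) *
        blockLik (g k) Y (dataIn xd (z i) (z k))) := by
        refine mul_le_mul h2 (h1.trans ?_) (mul_nonneg (blockLik_pos (hg j).2.1 (hg j).2.2.2 _ _).le
          (blockLik_pos (hg k).2.1 (hg k).2.2.2 _ _).le) hhB
        rw [← mergeConst]
        gcongr
    _ = _ := by ring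

lemma blockWeight_mul_le_move (hz : StrictMono z) (hg : GoodDens N g c₀ c₁ B₀) (hc₀ : 0 < c₀)
    (hτ : 0 < τ) (hB : 0 ≤ B) {c E : ℝ} (hc : |c| ≤ B₀ - τ) (xd : Fin n → ℝ) (Y : Fin n → ℝ)
    (hn : 1 ≤ n) {i j m k : Knot N} (hij : i < j) (hjm : j < m) (hmk : m < k)
    (hhalf : z m - z j ≤ z k - z m)
    (hd₀ : |meanOn Y (dataIn xd (z j) (z k))| ≤ B₀ - τ)
    (hE : (dataIn xd (z i) (z j)).card * (meanOn Y (dataIn xd (z i) (z j)) - c) ^ 2 +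
      (dataIn xd (z j) (z m)).card * ((meanOn Y (dataIn xd (z j) (z m)) - c) ^ 2 -
        (meanOn Y (dataIn xd (z j) (z m)) - meanOn Y (dataIn xd (z j) (z k))) ^ 2) ≤ E) :
    blockWeight z xd B g Y i j * blockWeight z xd B g Y j k ≤
      2 ^ B * moveConst c₀ c₁ τ * n * Real.exp (1 / 2 * E) *
        (blockWeight z xd B g Y i m * blockWeight z xd B g Y m k) := by
  have hu := dataIn_union hz xd hjm hmk
  have h1 := blockLik_mul_le_move (hg j).2.1 (hg j).2.2.1 (hg j).2.2.2 (hg k).2.1 (hg k).2.2.1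
    (hg k).1 (hg k).2.2.2 (hg m).2.1 (hg m).1 (hg m).2.2.2 hc₀ hτ hc Y
    (disjoint_dataIn xd (z i) (z j) (z m)) (disjoint_dataIn xd (z j) (z m) (z k))
    (by rwa [hu]) hn
  rw [hu, dataIn_union hz xd hij hjm] at h1
  have hzij := sub_pos.2 (hz hij)
  have hzjm := sub_pos.2 (hz hjm)
  have hzmk := sub_pos.2 (hz hmk)
  have h2 : (z j - z i) ^ B * (z k - z j) ^ B ≤
      2 ^ B * ((z m - z i) ^ B * (z k - z m) ^ B) := by
    have e : z k - z j = (z m - z j) + (z k - z m) := by ring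
    have e' : z m - z i = (z j - z i) + (z m - z j) := by ring
    rw [e, e']
    exact rpow_mul_rpow_le_move hzij hzjm hhalf hB
  have hL := (blockLik_pos (hg k).2.1 (hg k).2.2.2 Y (dataIn xd (z m) (z k))).le
  have hL' := (blockLik_pos (hg m).2.1 (hg m).2.2.2 Y (dataIn xd (z i) (z m))).le
  have hC := moveConst_nonneg (c₀ := c₀) (c₁ := c₁) (τ := τ)
  have hw : 0 ≤ 2 ^ B * ((z m - z i) ^ B * (z k - z m) ^ B) :=
    mul_nonneg (by positivity)
      (mul_nonneg (Real.rpow_nonneg (by linarith) _) (Real.rpow_nonneg (by linarith) _))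
  simp only [blockWeight]
  calc (z j - z i) ^ B * blockLik (g j) Y (dataIn xd (z i) (z j)) *
        ((z k - z j) ^ B * blockLik (g k) Y (dataIn xd (z j) (z k)))
      = (z j - z i) ^ B * (z k - z j) ^ B * (blockLik (g j) Y (dataIn xd (z i) (z j)) *
        blockLik (g k) Y (dataIn xd (z j) (z k))) := by ring
    _ ≤ 2 ^ B * ((z m - z i) ^ B * (z k - z m) ^ B) *
        (moveConst c₀ c₁ τ * n * Real.exp (1 / 2 * E) *
          (blockLik (g m) Y (dataIn xd (z i) (z m)) *
            blockLik (g k) Y (dataIn xd (z m) (z k)))) := by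
        refine mul_le_mul h2 (h1.trans ?_) (mul_nonneg (blockLik_pos (hg j).2.1 (hg j).2.2.2 _ _).le
          (blockLik_pos (hg k).2.1 (hg k).2.2.2 _ _).le) hw
        rw [← moveConst]
        gcongr
    _ = _ := by ring

lemma abs_meanOn_le_of_noiseSq_le {ε : Fin n → ℝ} {u : Finset (Fin n)} {L μ v : ℝ}
    (hL : 0 < L) (hμ : 0 < μ) (hv : 0 ≤ v) (hε : noiseSq ε u ≤ 16 * L)
    (hu : μ ^ 2 * L ≤ u.card * v ^ 2) :
    |meanOn ε u| ≤ 4 / μ * v := by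
  refine abs_le_of_sq_le_sq ?_ (by positivity)
  rw [noiseSq] at hε
  have hc : (0 : ℝ) < u.card := by
    by_contra h
    have : (u.card : ℝ) = 0 := le_antisymm (not_lt.1 h) (Nat.cast_nonneg _)
    rw [this] at hu
    nlinarith [mul_pos (pow_pos hμ 2) hL]
  rw [mul_pow, div_pow, div_mul_eq_mul_div, le_div_iff₀ (by positivity)]
  refine le_of_mul_le_mul_left ?_ (mul_pos hc hL)
  nlinarith [mul_le_mul hε hu (by positivity) (by positivity)]

/-- If the mean over the long block `(z j, z k]` is close to `f x`, merging is cheap; otherwise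
the posterior prefers to move the knot `z j` to `z m`. -/
lemma blockWeight_mul_le_far (hz : StrictMono z) (hg : GoodDens N g c₀ c₁ B₀) (hc₀ : 0 < c₀)
    (hτ : 0 < τ) (hB : 0 ≤ B) {c h w e s κ L D μ : ℝ} (hc : |c| ≤ B₀ - 2 * τ)
    (xd F ε : Fin n → ℝ) (hn : 1 ≤ n) (hs : 0 < s) (hκ : κ ≤ 1) (hL : 0 < L)
    (hμ : 0 < μ)
    (he : 0 ≤ e) (hw : 0 ≤ w) (hD : 4 * (w + 4 / μ) ≤ D) (hDe : D * e ≤ τ)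
    {i j m k : Knot N} (hij : i < j) (hjm : j < m) (hmk : m < k)
    (hhalf : z m - z j ≤ z k - z m) (hh : z j - z i ≤ h)
    (hFi : ∀ l ∈ dataIn xd (z i) (z j), |F l - c| ≤ w * e)
    (hFm : ∀ l ∈ dataIn xd (z j) (z m), |F l - c| ≤ w * e)
    (hFk : ∀ l ∈ dataIn xd (z j) (z k), |F l| ≤ B₀ - 2 * τ)
    (hni : (1 + 1 / s) * ((dataIn xd (z i) (z j)).card * ((w + D) * e) ^ 2) ≤ κ * L)
    (hnm : μ ^ 2 * L ≤ (dataIn xd (z j) (z m)).card * e ^ 2)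
    (hε : ∀ a b : Knot N, noiseSq ε (dataIn xd (z a) (z b)) ≤ 16 * L) :
    blockWeight z xd B g (fun l => F l + ε l) i j *
        blockWeight z xd B g (fun l => F l + ε l) j k ≤
      mergeConst c₀ c₁ τ * h ^ B *
        Real.exp (1 / 2 * ((1 + s) * noiseSq ε (dataIn xd (z i) (z j)) + κ * L)) *
        blockWeight z xd B g (fun l => F l + ε l) i k ∨
    blockWeight z xd B g (fun l => F l + ε l) i j *
        blockWeight z xd B g (fun l => F l + ε l) j k ≤
      2 ^ B * moveConst c₀ c₁ τ * n * Real.exp (-(6 * L)) *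
        (blockWeight z xd B g (fun l => F l + ε l) i m *
          blockWeight z xd B g (fun l => F l + ε l) m k) := by
  set Y : Fin n → ℝ := fun l => F l + ε l with hY
  set yJ := meanOn Y (dataIn xd (z j) (z k)) with hyJ
  have hμ' : 0 < 4 / μ := by positivity
  have hD0 : 0 ≤ D := by linarith
  by_cases hcase : |yJ - c| ≤ D * e
  · left
    have habs : |yJ| ≤ B₀ - τ := by
      have := abs_add_le c (yJ - c)
      rw [add_sub_cancel] at this
      linarith
    refine blockWeight_mul_le_merge hz hg hc₀ hτ hB habs xd Y hij (hjm.trans hmk) hh ?_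
    have hFi' : ∀ l ∈ dataIn xd (z i) (z j), |F l - yJ| ≤ (w + D) * e := fun l hl => by
      have := abs_sub_le (F l) c yJ
      rw [abs_sub_comm c] at this
      linarith [hFi l hl]
    have := card_mul_sq_le (ε := ε) hs hFi'
    rw [sub_self]
    linarith
  · right
    rw [not_le] at hcase
    have hμL : 0 < μ ^ 2 * L := by positivity
    have hne : (dataIn xd (z j) (z m)).Nonempty := by
      rw [← Finset.card_pos, Nat.pos_iff_ne_zero]
      intro h0
      rw [h0] at hnm
      norm_num at hnm
      linarith
    have hsub : dataIn xd (z j) (z m) ⊆ dataIn xd (z j) (z k) := by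
      rw [← dataIn_union hz xd hjm hmk]
      exact Finset.subset_union_left
    have hne' := hne.mono hsub
    have hcard : ((dataIn xd (z j) (z m)).card : ℝ) ≤ (dataIn xd (z j) (z k)).card := by
      exact_mod_cast Finset.card_le_card hsub
    have hεJ := abs_meanOn_le_of_noiseSq_le hL hμ he (hε j k)
      (hnm.trans (mul_le_mul_of_nonneg_right hcard (sq_nonneg e)))
    have hεm := abs_meanOn_le_of_noiseSq_le hL hμ he (hε j m) hnm
    have habs : |yJ| ≤ B₀ - τ := by
      have h1 := abs_meanOn_add_sub_le (c := 0) (w := B₀ - 2 * τ) hne'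
        (fun l hl => by rw [sub_zero]; exact hFk l hl) hεJ
      rw [sub_zero, ← hY, ← hyJ] at h1
      have h2 : 4 / μ * e ≤ D * e := mul_le_mul_of_nonneg_right (by linarith) he
      linarith
    have hym := abs_meanOn_add_sub_le hne hFm hεm
    rw [← hY, ← add_mul] at hym
    have hexp : -(6 * L) = 1 / 2 * (-(12 * L)) := by ring
    rw [hexp]
    refine blockWeight_mul_le_move hz hg hc₀ hτ hB (hc.trans (by linarith)) xd Y hn hij hjm hmk
      hhalf habs ?_
    rw [← hyJ]
    set ym := meanOn Y (dataIn xd (z j) (z m))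
    have hA : (w + 4 / μ) * e ≤ D * e / 4 := by
      linarith [mul_le_mul_of_nonneg_right hD he]
    have hDe0 : 0 ≤ D * e := mul_nonneg hD0 he
    have h1 : (ym - c) ^ 2 ≤ (D * e) ^ 2 / 16 := by
      have := sq_le_sq' (by linarith [(abs_le.1 hym).1]) ((abs_le.1 hym).2.trans hA)
      linarith
    have h2 : 9 / 16 * (D * e) ^ 2 ≤ (ym - yJ) ^ 2 := by
      have h3 : 3 / 4 * (D * e) ≤ |ym - yJ| := by
        have := abs_sub_le yJ ym c
        rw [abs_sub_comm yJ ym] at this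
        linarith
      have := pow_le_pow_left₀ (by positivity) h3 2
      rw [sq_abs] at this
      linarith
    have h3 : (dataIn xd (z j) (z m)).card * ((ym - c) ^ 2 - (ym - yJ) ^ 2) ≤
        (dataIn xd (z j) (z m)).card * (-(1 / 2) * (D * e) ^ 2) :=
      mul_le_mul_of_nonneg_left (by linarith) (Nat.cast_nonneg _)
    have h4 : 256 * L ≤ D ^ 2 * ((dataIn xd (z j) (z m)).card * e ^ 2) := by
      have hDμ : 16 ≤ D * μ := by
        have := mul_le_mul_of_nonneg_right hD hμ.le
        have e2 : 4 * (w + 4 / μ) * μ = 4 * w * μ + 16 := by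
          field_simp
          ring
        linarith [mul_nonneg hw hμ.le]
      calc 256 * L = 16 ^ 2 * L := by norm_num
        _ ≤ (D * μ) ^ 2 * L := by gcongr
        _ = D ^ 2 * (μ ^ 2 * L) := by ring
        _ ≤ _ := by gcongr
    have h5 := card_mul_sq_le (ε := ε) one_pos hFi
    rw [← hY] at h5
    have h6 : (dataIn xd (z i) (z j)).card * (w * e) ^ 2 ≤ L := by
      have a1 : (w * e) ^ 2 ≤ ((w + D) * e) ^ 2 := by
        have : w * e ≤ (w + D) * e := mul_le_mul_of_nonneg_right (by linarith) he
        gcongr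
      have a2 : 1 ≤ 1 + 1 / s := by
        have : 0 < 1 / s := by positivity
        linarith
      calc (dataIn xd (z i) (z j)).card * (w * e) ^ 2
          ≤ (dataIn xd (z i) (z j)).card * ((w + D) * e) ^ 2 := by gcongr
        _ ≤ (1 + 1 / s) * ((dataIn xd (z i) (z j)).card * ((w + D) * e) ^ 2) :=
          le_mul_of_one_le_left (by positivity) a2
        _ ≤ κ * L := hni
        _ ≤ L := mul_le_of_le_one_left hL.le hκ
    have h7 := hε i j
    norm_num at h5
    linarith

lemma blockWeight_mul_le_near (hz : StrictMono z) (hg : GoodDens N g c₀ c₁ B₀) (hc₀ : 0 < c₀)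
    (hτ : 0 < τ) (hB : 0 ≤ B) {c h w s κ L : ℝ} (hc : |c| ≤ B₀ - 2 * τ)
    (xd F ε : Fin n → ℝ) (hs : 0 < s) {i j k : Knot N} (hij : i < j) (hjk : j < k)
    (hh : z j - z i ≤ h)
    (hFi : ∀ l ∈ dataIn xd (z i) (z j), |F l - c| ≤ w)
    (hFk : ∀ l ∈ dataIn xd (z j) (z k), |F l - c| ≤ w)
    (hnik : (1 + 1 / s) * ((dataIn xd (z i) (z j)).card * w ^ 2 +
      (dataIn xd (z j) (z k)).card * w ^ 2) ≤ κ * L) :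
    blockWeight z xd B g (fun l => F l + ε l) i j *
        blockWeight z xd B g (fun l => F l + ε l) j k ≤
      mergeConst c₀ c₁ τ * h ^ B *
        Real.exp (1 / 2 * ((1 + s) * (noiseSq ε (dataIn xd (z i) (z j)) +
          noiseSq ε (dataIn xd (z j) (z k))) + κ * L)) *
        blockWeight z xd B g (fun l => F l + ε l) i k := by
  refine blockWeight_mul_le_merge hz hg hc₀ hτ hB (hc.trans (by linarith)) xd _ hij hjk hh ?_
  have h1 := card_mul_sq_le (ε := ε) hs hFi
  have h2 := card_mul_sq_le (ε := ε) hs hFk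
  linarith

end WeightBounds

section PosteriorBound

variable {n N : ℕ} {z : Knot N → ℝ} {g : Knot N → ℝ → ℝ} {c₀ c₁ B₀ τ B : ℝ}

lemma totalMass_pos {T : Knot N → Knot N → ℝ} (hT : ∀ i j, i < j → 0 < T i j) :
    0 < totalMass T := by
  refine Finset.sum_pos (fun S _ => blockProd_pos hT S) ⟨Finset.univ, ?_⟩
  exact Finset.mem_filter.2 ⟨Finset.mem_univ _, Finset.mem_univ _, Finset.mem_univ _⟩

lemma partPost_nonneg (hz : StrictMono z) (hg : GoodDens N g c₀ c₁ B₀) (xd : Fin n → ℝ)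
    (Y : Fin n → ℝ) (A : Finset (Knot N) → Prop) :
    0 ≤ partPost n N z xd B g Y (fun S _ => A S) := by
  have hT : ∀ i j : Knot N, i < j → 0 < blockWeight z xd B g Y i j := fun i j hij =>
    blockWeight_pos hz (fun i => (hg i).2.1) (fun i => (hg i).2.2.2) xd B Y hij
  rw [partPost_eq hz (fun i => (hg i).2.1) (fun i => (hg i).2.2.2)]
  exact div_nonneg (Finset.sum_nonneg fun S _ => (blockProd_pos hT S).le) (totalMass_pos hT).le

lemma partPost_le_one (hz : StrictMono z) (hg : GoodDens N g c₀ c₁ B₀) (xd : Fin n → ℝ)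
    (Y : Fin n → ℝ) (A : Finset (Knot N) → Prop) :
    partPost n N z xd B g Y (fun S _ => A S) ≤ 1 := by
  have hT : ∀ i j : Knot N, i < j → 0 < blockWeight z xd B g Y i j := fun i j hij =>
    blockWeight_pos hz (fun i => (hg i).2.1) (fun i => (hg i).2.2.2) xd B Y hij
  rw [partPost_eq hz (fun i => (hg i).2.1) (fun i => (hg i).2.2.2)]
  refine div_le_one_of_le₀ ?_ (totalMass_pos hT).le
  exact Finset.sum_le_sum_of_subset_of_nonneg (Finset.filter_subset _ _)
    fun S _ _ => (blockProd_pos hT S).le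

lemma mul_exp_rpow_eq {W E θ : ℝ} (hW : 0 ≤ W) {κ s v L : ℝ}
    (hE : E = 1 / 2 * ((1 + s) * v + κ * L)) :
    (W * Real.exp E) ^ θ =
      (W * Real.exp (1 / 2 * (κ * L))) ^ θ * Real.exp (θ * (1 + s) / 2 * v) := by
  rw [Real.mul_rpow hW (Real.exp_pos _).le, Real.mul_rpow hW (Real.exp_pos _).le, mul_assoc,
    ← Real.exp_mul, ← Real.exp_mul, ← Real.exp_add, hE]
  congr 2
  ring

/-- Expected posterior mass of a family `A` of partitions having a short block, listed in `Q`,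
whose right end can be removed or moved to the right. -/
lemma integral_partPost_le (hz : StrictMono z) (hg : GoodDens N g c₀ c₁ B₀) (hc₀ : 0 < c₀)
    (hτ : 0 < τ) (hB : 0 ≤ B) (hn : 1 ≤ n) {c h w e s κ L D μ θ C C' : ℝ} {K : ℕ}
    (hc : |c| ≤ B₀ - 2 * τ) (xd F : Fin n → ℝ) (hs : 0 < s) (hκ : κ ≤ 1) (hL : 0 < L)
    (hμ : 0 < μ) (he : 0 ≤ e) (hw : 0 ≤ w) (hh : 0 ≤ h) (hD : 4 * (w + 4 / μ) ≤ D)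
    (hDe : D * e ≤ τ) (hθ₀ : 0 ≤ θ) (hθ : θ ≤ 1)
    (hC : ∀ u u' : Finset (Fin n), Disjoint u u' →
      Integrable (fun ε : Fin n → ℝ =>
        Real.exp (θ * (1 + s) / 2 * (noiseSq ε u + noiseSq ε u'))) (regNoise n) ∧
      ∫ ε, Real.exp (θ * (1 + s) / 2 * (noiseSq ε u + noiseSq ε u')) ∂regNoise n ≤ C)
    (hC' : ∀ u u' : Finset (Fin n), Disjoint u u' →
      Integrable (fun ε : Fin n → ℝ =>
        Real.exp (1 / 2 / 2 * (noiseSq ε u + noiseSq ε u'))) (regNoise n) ∧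
      ∫ ε, Real.exp (1 / 2 / 2 * (noiseSq ε u + noiseSq ε u')) ∂regNoise n ≤ C')
    (A : Finset (Knot N) → Prop) (Q : Finset (Knot N × Knot N))
    (near : Knot N → Finset (Knot N)) (m : Knot N → Knot N)
    (hQA : ∀ S, IsPart N S → A S → ∃ q ∈ Q, Consec N S q.1 q.2 ∧ ∃ k, Consec N S q.2 k)
    (hQ : ∀ q ∈ Q, q.1 < q.2 ∧ z q.2 - z q.1 ≤ h ∧
      (∀ l ∈ dataIn xd (z q.1) (z q.2), |F l - c| ≤ w * e) ∧
      (1 + 1 / s) * ((dataIn xd (z q.1) (z q.2)).card * ((w + D) * e) ^ 2) ≤ κ * L)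
    (hF : ∀ j k : Knot N, ∀ l ∈ dataIn xd (z j) (z k), |F l| ≤ B₀ - 2 * τ)
    (hnear : ∀ q ∈ Q, ∀ k ∈ near q.2, q.2 < k →
      (∀ l ∈ dataIn xd (z q.2) (z k), |F l - c| ≤ w * e) ∧
      (1 + 1 / s) * ((dataIn xd (z q.1) (z q.2)).card * (w * e) ^ 2 +
        (dataIn xd (z q.2) (z k)).card * (w * e) ^ 2) ≤ κ * L)
    (hfar : ∀ q ∈ Q, ∀ k ∉ near q.2, q.2 < k →
      q.2 < m q.2 ∧ m q.2 < k ∧ z (m q.2) - z q.2 ≤ z k - z (m q.2) ∧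
      (∀ l ∈ dataIn xd (z q.2) (z (m q.2)), |F l - c| ≤ w * e) ∧
      μ ^ 2 * L ≤ (dataIn xd (z q.2) (z (m q.2))).card * e ^ 2)
    (hQK : Q.card ≤ K ^ 2) (hnK : ∀ q ∈ Q, (near q.2).card ≤ K) :
    ∫ ε, partPost n N z xd B g (fun l => F l + ε l) (fun S _ => A S) ∂regNoise n ≤
      ((N : ℝ) + 1) ^ 2 * (Real.exp (-(4 * L)) * C') +
        K ^ 2 * (((K : ℝ) + 1) * ((mergeConst c₀ c₁ τ * h ^ B * Real.exp (1 / 2 * (κ * L))) ^ θ * C)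
          + 2 ^ B * moveConst c₀ c₁ τ * n * Real.exp (-(6 * L))) := by
  set W := (mergeConst c₀ c₁ τ * h ^ B * Real.exp (1 / 2 * (κ * L))) ^ θ with hW
  set V := 2 ^ B * moveConst c₀ c₁ τ * n * Real.exp (-(6 * L)) with hV
  have hM : 0 ≤ mergeConst c₀ c₁ τ * h ^ B :=
    mul_nonneg (mergeConst_nonneg hc₀ hτ) (Real.rpow_nonneg hh _)
  have hV0 : 0 ≤ V := by
    have := moveConst_nonneg (c₀ := c₀) (c₁ := c₁) (τ := τ)
    rw [hV]
    positivity
  have hW0 : 0 ≤ W := Real.rpow_nonneg (mul_nonneg hM (Real.exp_pos _).le) _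
  set d : Knot N → Knot N → Finset (Fin n) := fun i j => dataIn xd (z i) (z j) with hd
  set G : Finset (Fin n) → Finset (Fin n) → (Fin n → ℝ) → ℝ := fun u u' ε =>
    Real.exp (θ * (1 + s) / 2 * (noiseSq ε u + noiseSq ε u')) with hG
  set bd : (Fin n → ℝ) → ℝ := fun ε =>
    ∑ p : Knot N × Knot N, Real.exp (-(4 * L)) *
      Real.exp (1 / 2 / 2 * (noiseSq ε (d p.1 p.2) + noiseSq ε ∅)) +
    ∑ q ∈ Q, (∑ k ∈ near q.2, W * G (d q.1 q.2) (d q.2 k) ε + W * G (d q.1 q.2) ∅ ε + V)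
    with hbd
  have hG0 : ∀ u u' ε, 0 ≤ G u u' ε := fun u u' ε => (Real.exp_pos _).le
  have hpt : ∀ ε, partPost n N z xd B g (fun l => F l + ε l) (fun S _ => A S) ≤ bd ε := by
    intro ε
    have hs1 : 0 ≤ ∑ p : Knot N × Knot N, Real.exp (-(4 * L)) *
      Real.exp (1 / 2 / 2 * (noiseSq ε (d p.1 p.2) + noiseSq ε ∅)) :=
      Finset.sum_nonneg fun p _ => by positivity
    have hs2 : 0 ≤ ∑ q ∈ Q,
        (∑ k ∈ near q.2, W * G (d q.1 q.2) (d q.2 k) ε + W * G (d q.1 q.2) ∅ ε + V) :=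
      Finset.sum_nonneg fun q _ => add_nonneg (add_nonneg (Finset.sum_nonneg fun k _ =>
        mul_nonneg hW0 (hG0 _ _ _)) (mul_nonneg hW0 (hG0 _ _ _))) hV0
    by_cases hε : ∀ a b : Knot N, noiseSq ε (d a b) ≤ 16 * L
    · refine le_trans ?_ (le_add_of_nonneg_left hs1)
      have hT : ∀ i j : Knot N, i < j → 0 < blockWeight z xd B g (fun l => F l + ε l) i j :=
        fun i j hij => blockWeight_pos hz (fun i => (hg i).2.1) (fun i => (hg i).2.2.2) xd B _ hij
      rw [partPost_eq hz (fun i => (hg i).2.1) (fun i => (hg i).2.2.2),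
        div_le_iff₀ (totalMass_pos hT)]
      have main := sum_blockProd_le hT (Finset.filter_subset A (parts N)) Q near m
        (fun q k => mergeConst c₀ c₁ τ * h ^ B * Real.exp (1 / 2 * ((1 + s) *
          (noiseSq ε (d q.1 q.2) + noiseSq ε (d q.2 k)) + κ * L)))
        (fun q => mergeConst c₀ c₁ τ * h ^ B * Real.exp (1 / 2 * ((1 + s) *
          (noiseSq ε (d q.1 q.2) + noiseSq ε ∅) + κ * L))) (V := V) (θ := θ)
        (fun _ _ => mul_nonneg hM (Real.exp_pos _).le)
        (fun _ => mul_nonneg hM (Real.exp_pos _).le) hV0 hθ hθ₀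
        (fun S hS => by
          rw [Finset.mem_filter] at hS
          exact hQA S (by simpa [parts] using hS.1) hS.2)
        (fun q hq k hk hqk => by
          obtain ⟨h1, h2, h3, -⟩ := hQ q hq
          obtain ⟨h4, h5⟩ := hnear q hq k hk hqk
          exact blockWeight_mul_le_near hz hg hc₀ hτ hB hc xd F ε hs h1 hqk h2 h3 h4 h5)
        (fun q hq k hk hqk => by
          obtain ⟨h1, h2, h3, h3'⟩ := hQ q hq
          obtain ⟨h4, h5, h6, h7, h8⟩ := hfar q hq k hk hqk
          rw [noiseSq_empty, add_zero]
          exact (blockWeight_mul_le_far hz hg hc₀ hτ hB hc xd F ε hn hs hκ hL hμ he hw hD hDe h1 h4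
            h5 h6 h2 h3 h7 (hF _ _) h3' h8 hε).imp id fun h9 => ⟨h4, h5, h9⟩)
      simpa only [mul_exp_rpow_eq hM rfl] using main
    · push Not at hε
      obtain ⟨a, b, hab⟩ := hε
      refine (partPost_le_one hz hg xd _ A).trans ((le_add_of_nonneg_right hs2).trans' ?_)
      refine le_trans ?_ (Finset.single_le_sum (f := fun p : Knot N × Knot N =>
        Real.exp (-(4 * L)) * Real.exp (1 / 2 / 2 * (noiseSq ε (d p.1 p.2) + noiseSq ε ∅)))
        (fun p _ => by positivity) (Finset.mem_univ (a, b)))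
      rw [← Real.exp_add, noiseSq_empty]
      exact Real.one_le_exp (by linarith)
  have hi1 : ∀ p : Knot N × Knot N, Integrable (fun ε : Fin n → ℝ => Real.exp (-(4 * L)) *
      Real.exp (1 / 2 / 2 * (noiseSq ε (d p.1 p.2) + noiseSq ε ∅))) (regNoise n) := fun p =>
    (hC' _ _ (Finset.disjoint_empty_right _)).1.const_mul _
  have hi2 : ∀ q : Knot N × Knot N, ∀ k, Integrable (fun ε : Fin n → ℝ =>
      W * G (d q.1 q.2) (d q.2 k) ε) (regNoise n) := fun q k =>
    (hC _ _ (disjoint_dataIn xd _ _ _)).1.const_mul _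
  have hi3 : ∀ q : Knot N × Knot N, Integrable (fun ε : Fin n → ℝ =>
      W * G (d q.1 q.2) ∅ ε) (regNoise n) := fun q =>
    (hC _ _ (Finset.disjoint_empty_right _)).1.const_mul _
  have hi4 : ∀ q : Knot N × Knot N, Integrable (fun ε : Fin n → ℝ =>
      ∑ k ∈ near q.2, W * G (d q.1 q.2) (d q.2 k) ε) (regNoise n) := fun q =>
    integrable_finsetSum _ fun k _ => hi2 q k
  have hi5 : ∀ q : Knot N × Knot N, Integrable (fun ε : Fin n → ℝ =>
      ∑ k ∈ near q.2, W * G (d q.1 q.2) (d q.2 k) ε + W * G (d q.1 q.2) ∅ ε + V)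
      (regNoise n) := fun q => ((hi4 q).add (hi3 q)).add (integrable_const V)
  have hI1 : Integrable (fun ε => ∑ p : Knot N × Knot N, Real.exp (-(4 * L)) *
      Real.exp (1 / 2 / 2 * (noiseSq ε (d p.1 p.2) + noiseSq ε ∅))) (regNoise n) :=
    integrable_finsetSum _ fun p _ => hi1 p
  have hI2 : Integrable (fun ε => ∑ q ∈ Q, (∑ k ∈ near q.2, W * G (d q.1 q.2) (d q.2 k) ε +
      W * G (d q.1 q.2) ∅ ε + V)) (regNoise n) :=
    integrable_finsetSum _ fun q _ => hi5 q
  have hC0 : 0 ≤ C := (integral_nonneg fun ε => hG0 ∅ ∅ ε).trans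
    (hC ∅ ∅ (Finset.disjoint_empty_right _)).2
  have hWC : 0 ≤ W * C := mul_nonneg hW0 hC0
  refine (integral_mono_of_nonneg (ae_of_all _ fun ε => partPost_nonneg hz hg xd _ A)
    (hI1.add hI2) (ae_of_all _ hpt)).trans ?_
  rw [integral_add' hI1 hI2, integral_finsetSum _ fun p _ => hi1 p,
    integral_finsetSum _ fun q _ => hi5 q]
  refine add_le_add ?_ ?_
  · calc _ ≤ ∑ _p : Knot N × Knot N, Real.exp (-(4 * L)) * C' := by
          refine Finset.sum_le_sum fun p _ => ?_
          rw [integral_const_mul]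
          exact mul_le_mul_of_nonneg_left (hC' _ _ (Finset.disjoint_empty_right _)).2
            (Real.exp_pos _).le
      _ = _ := by
          rw [Finset.sum_const, nsmul_eq_mul, Finset.card_univ, Fintype.card_prod, Fintype.card_fin]
          push_cast
          ring
  · calc _ ≤ ∑ _q ∈ Q, (((K : ℝ) + 1) * (W * C) + V) := by
          refine Finset.sum_le_sum fun q hq => ?_
          have e1 := integral_add ((hi4 q).add (hi3 q)) (integrable_const V)
          have e2 := integral_add (hi4 q) (hi3 q)
          simp only [Pi.add_apply] at e1
          rw [e1, e2, integral_finsetSum _ fun k _ => hi2 q k, integral_const, probReal_univ,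
            one_smul, add_mul, one_mul]
          refine add_le_add (add_le_add ?_ ?_) le_rfl
          · calc _ ≤ ∑ _k ∈ near q.2, W * C := Finset.sum_le_sum fun k _ => by
                  rw [integral_const_mul]
                  exact mul_le_mul_of_nonneg_left (hC _ _ (disjoint_dataIn xd _ _ _)).2 hW0
              _ ≤ _ := by
                  rw [Finset.sum_const, nsmul_eq_mul]
                  exact mul_le_mul_of_nonneg_right (by exact_mod_cast hnK q hq) hWC
          · rw [integral_const_mul]
            exact mul_le_mul_of_nonneg_left (hC _ _ (Finset.disjoint_empty_right _)).2 hW0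
      _ ≤ _ := by
          rw [Finset.sum_const, nsmul_eq_mul]
          exact mul_le_mul_of_nonneg_right (by exact_mod_cast hQK) (by positivity)

end PosteriorBound

section Grid

variable {n N : ℕ} {z : Knot N → ℝ} {C₁ C₂ : ℝ}

lemma grid_mul_sub_le {d : ℝ} (hd : ∀ i : Fin N, d ≤ z i.succ - z i.castSucc) {i j : Knot N}
    (hij : i ≤ j) : ((j : ℕ) - (i : ℕ) : ℝ) * d ≤ z j - z i := by
  induction j using Fin.induction with
  | zero =>
    have : i = 0 := Fin.le_zero_iff.1 hij
    simp [this]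
  | succ j ih =>
    rcases hij.eq_or_lt with rfl | h
    · simp
    · have h1 := ih (Fin.le_castSucc_iff.2 h)
      have h2 := hd j
      simp only [Fin.val_castSucc, Fin.val_succ] at h1 ⊢
      push_cast
      linarith

lemma strictMono_of_gap {d : ℝ} (hd0 : 0 < d) (hd : ∀ i : Fin N, d ≤ z i.succ - z i.castSucc) :
    StrictMono z := by
  refine Fin.strictMono_iff_lt_succ.2 fun i => ?_
  linarith [hd i]

lemma card_mul_gap_le {d u v : ℝ} (hd0 : 0 ≤ d) (hd : ∀ i : Fin N, d ≤ z i.succ - z i.castSucc)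
    (huv : u ≤ v) {A : Finset (Knot N)} (hA : ∀ i ∈ A, u ≤ z i ∧ z i ≤ v) :
    A.card * d ≤ v - u + d := by
  rcases A.eq_empty_or_nonempty with rfl | hne
  · simp only [Finset.card_empty, Nat.cast_zero, zero_mul]; linarith
  have h1 : A ⊆ Finset.Icc (A.min' hne) (A.max' hne) := fun i hi =>
    Finset.mem_Icc.2 ⟨A.min'_le i hi, A.le_max' i hi⟩
  have h2 := Finset.card_le_card h1
  have hmm : A.min' hne ≤ A.max' hne := A.min'_le_max' hne
  rw [Fin.card_Icc] at h2
  have h3 : (A.card : ℝ) ≤ ((A.max' hne : ℕ) - (A.min' hne : ℕ) : ℝ) + 1 := by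
    have h4 : A.card + (A.min' hne : ℕ) ≤ (A.max' hne : ℕ) + 1 := by
      have := Fin.le_def.1 hmm
      omega
    have : ((A.card + (A.min' hne : ℕ) : ℕ) : ℝ) ≤ ((A.max' hne : ℕ) + 1 : ℕ) := by
      exact_mod_cast h4
    push_cast at this
    linarith
  have h5 := grid_mul_sub_le hd hmm
  have h6 := (hA _ (A.min'_mem hne)).1
  have h7 := (hA _ (A.max'_mem hne)).2
  nlinarith

lemma exists_knot_between {d r : ℝ} (hz : StrictMono z)
    (hd : ∀ i : Fin N, z i.succ - z i.castSucc ≤ d) (hr : 0 < r) {j k : Knot N}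
    (hk : z j + r ≤ z k) : ∃ m, z j + r ≤ z m ∧ z m ≤ z j + r + d := by
  set A : Finset (Knot N) := Finset.univ.filter fun m => z j + r ≤ z m with hA
  have hne : A.Nonempty := ⟨k, by simp [hA, hk]⟩
  have hmem := A.min'_mem hne
  have hmin := fun a ha => A.min'_le a ha
  set m := A.min' hne
  have hm : z j + r ≤ z m := by simpa [hA] using hmem
  have hm0 : m ≠ 0 := by
    intro h0
    have := hz.monotone (Fin.zero_le j)
    rw [h0] at hm
    linarith
  refine ⟨m, hm, ?_⟩
  obtain ⟨m', hm'⟩ := Fin.exists_succ_eq.2 hm0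
  by_contra hcon
  have h1 := hd m'
  rw [hm'] at h1
  have h2 : m'.castSucc ∈ A := by
    simp only [hA, Finset.mem_filter, Finset.mem_univ, true_and]
    linarith [not_le.1 hcon]
  have h3 : m ≤ m'.castSucc := hmin _ h2
  rw [← hm'] at h3
  exact absurd h3 (not_le.2 Fin.castSucc_lt_succ)

lemma half_le_of_abs_sub_le {a P u L : ℝ} (hu : 0 ≤ u) (hP : 0 ≤ P)
    (h : |a - P| ≤ u * √(L * P)) (hL : 4 * u ^ 2 * L ≤ P) : P / 2 ≤ a := by
  have h1 : u * √(L * P) ≤ P / 2 := by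
    rw [← Real.sqrt_sq hu, ← Real.sqrt_mul (sq_nonneg u)]
    refine Real.sqrt_le_iff.2 ⟨by linarith, ?_⟩
    nlinarith
  linarith [(abs_le.1 h).1]

lemma le_of_abs_sub_le {a P u L : ℝ} (hL : 0 ≤ L) (hP : 0 ≤ P)
    (h : |a - P| ≤ u * √(L * P)) : a ≤ 3 / 2 * P + u ^ 2 * L / 2 := by
  have h1 : u * √(L * P) ≤ (u ^ 2 * L + P) / 2 := by
    rw [Real.sqrt_mul hL]
    nlinarith [sq_nonneg (u * √L - √P), Real.sq_sqrt hL, Real.sq_sqrt hP]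
  linarith [(abs_le.1 h).2]

lemma consec_of_lt_of_le {i j k : Knot N} (hij : i < j) (hjk : j ≤ k) :
    Consec N {0, i, j, k, Fin.last N} i j := by
  refine ⟨by simp, by simp, hij, fun m hm h => ?_⟩
  simp only [Finset.mem_insert, Finset.mem_singleton] at hm
  rcases hm with rfl | rfl | rfl | rfl | rfl
  · exact absurd h.1 (Fin.not_lt_zero _)
  · exact lt_irrefl _ h.1
  · exact lt_irrefl _ h.2
  · exact absurd h.2 (not_lt.2 hjk)
  · exact absurd h.2 (not_lt.2 (Fin.le_last _))

lemma consec_of_le_of_lt {i j k : Knot N} (hij : i ≤ j) (hjk : j < k) :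
    Consec N {0, i, j, k, Fin.last N} j k := by
  refine ⟨by simp, by simp, hjk, fun m hm h => ?_⟩
  simp only [Finset.mem_insert, Finset.mem_singleton] at hm
  rcases hm with rfl | rfl | rfl | rfl | rfl
  · exact absurd h.1 (Fin.not_lt_zero _)
  · exact absurd h.1 (not_lt.2 hij)
  · exact lt_irrefl _ h.1
  · exact lt_irrefl _ h.2
  · exact absurd h.2 (not_lt.2 (Fin.le_last _))

lemma mem_IcalPairs_self {x : ℝ} {i j : Knot N} (hij : i < j) (hx : x ∈ Set.Ioc (z i) (z j)) :
    (i, j) ∈ IcalPairs N z x :=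
  ⟨{0, i, j, j, Fin.last N}, ⟨by simp, by simp⟩, consec_of_lt_of_le hij le_rfl, Or.inl hx⟩

lemma mem_IcalPairs_right {x : ℝ} {i j k : Knot N} (hij : i < j) (hjk : j < k)
    (hx : x ∈ Set.Ioc (z i) (z j)) : (j, k) ∈ IcalPairs N z x :=
  ⟨{0, i, j, k, Fin.last N}, ⟨by simp, by simp⟩, consec_of_le_of_lt hij.le hjk,
    Or.inr ⟨i, j, consec_of_lt_of_le hij hjk.le, hx, Or.inl rfl⟩⟩

lemma nIx_eq (hz : StrictMono z) (xd : Fin n → ℝ) {S : Finset (Knot N)} {x : ℝ} {i j : Knot N}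
    (h : Consec N S i j) (hx : x ∈ Set.Ioc (z i) (z j)) :
    nIx n N xd z S x = (dataIn xd (z i) (z j)).card := by
  have hu : ∀ i' j', Consec N S i' j' ∧ x ∈ Set.Ioc (z i') (z j') → i' = i ∧ j' = j :=
    fun i' j' h' => consec_mem_unique hz h'.1 h'.2 h hx
  rw [nIx, Finset.sum_eq_single i, Finset.sum_eq_single j, if_pos ⟨h, hx⟩]
  · rfl
  · exact fun j' _ hj' => if_neg fun h' => hj' (hu _ _ h').2
  · simp
  · exact fun i' _ hi' => Finset.sum_eq_zero fun j' _ => if_neg fun h' => hi' (hu _ _ h').1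
  · simp

end Grid

section Design

variable {n N : ℕ} {z : Knot N → ℝ} {g : Knot N → ℝ → ℝ}
  {B B₀ C₁ C₂ c₀ c₁ p₀ p₁ u₁ x : ℝ} {pI : ℝ → ℝ → ℝ}

lemma gap_le_of_card_le {xd : Fin n → ℝ} (hΩ : OmegaX n N xd z pI u₁ x)
    (hz : StrictMono z) (hu₁ : 0 < u₁) (hp₀ : 0 < p₀) (hn : 1 ≤ n)
    (hpI : ∀ a b : ℝ, a ≤ b → p₀ * (b - a) ≤ pI a b ∧ pI a b ≤ p₁ * (b - a))
    {δ h : ℝ} (hu : 2 * u₁ ^ 2 * Real.log n ≤ δ * (n * h)) {q : Knot N × Knot N}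
    (hq : q ∈ IcalPairs N z x) (hc : ((dataIn xd (z q.1) (z q.2)).card : ℝ) ≤ δ * (n * h)) :
    p₀ * (z q.2 - z q.1) ≤ 2 * δ * h := by
  have hn0 : (0 : ℝ) < n := by exact_mod_cast hn
  have hlt : q.1 < q.2 := by
    obtain ⟨S, -, h, -⟩ := hq
    exact h.2.2.1
  have hlen := hz.monotone hlt.le
  obtain ⟨h1, -⟩ := hpI _ _ hlen
  have h0 : 0 ≤ p₀ * (z q.2 - z q.1) := mul_nonneg hp₀.le (by linarith)
  by_contra hcon
  push Not at hcon
  have h2 : 2 * (δ * (n * h)) < n * pI (z q.1) (z q.2) := by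
    have := mul_lt_mul_of_pos_left (hcon.trans_le h1) hn0
    linarith
  have h3 := half_le_of_abs_sub_le hu₁.le (by nlinarith) (hΩ q hq) (by linarith)
  have h4 : ((nIv n xd (z q.1) (z q.2) : ℕ) : ℝ) = (dataIn xd (z q.1) (z q.2)).card := rfl
  linarith

/-- The conclusion of `integral_partPost_le` for the event that the block containing `x` carries
few observations, on the design event and at bandwidth `h` with `n h e² = log n`. -/
lemma exists_integral_partPost_nIx_le (hgrid : IsGrid n N z C₁ C₂) (hC₁ : 0 < C₁)
    (hg : GoodDens N g c₀ c₁ B₀) (hc₀ : 0 < c₀) (hB : 0 ≤ B) (hn : 1 ≤ n)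
    (hL : 0 < Real.log n) (hx : x ∈ Set.Ioo (0 : ℝ) 1) (hu₁ : 0 < u₁) (hp₀ : 0 < p₀)
    (hp₀₁ : p₀ ≤ p₁)
    (hpI : ∀ a b : ℝ, a ≤ b → p₀ * (b - a) ≤ pI a b ∧ pI a b ≤ p₁ * (b - a))
    {xd : Fin n → ℝ} (hΩ : OmegaX n N xd z pI u₁ x)
    {f : ℝ → ℝ} {τ M h e ρ δ s κ μ D θ C C' : ℝ}
    (hf : ∀ y ∈ Set.Icc (0 : ℝ) 1, |f y| ≤ B₀ - 2 * τ)
    (hfx : ∀ y ∈ Set.Icc (0 : ℝ) 1, |y - x| ≤ h → |f y - f x| ≤ M * e)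
    (hτ : 0 < τ) (hM : 0 ≤ M) (hh : 0 < h) (he : 0 ≤ e) (hhe : n * h * e ^ 2 = Real.log n)
    (hρ : 0 < ρ) (hρ' : ρ ≤ 1 / 2) (hμ : 0 < μ) (hμ' : μ ^ 2 = p₀ * ρ / 8)
    (hD : 4 * (M + 4 / μ) ≤ D) (hDe : D * e ≤ τ) (hδ : 0 < δ) (hδρ : 8 * δ ≤ p₀ * ρ)
    (hs : 0 < s) (hκ : κ ≤ 1) (hδκ : (1 + 1 / s) * (δ * (M + D) ^ 2) ≤ κ / 2)
    (hρκ : (1 + 1 / s) * (2 * p₁ * ρ * M ^ 2) ≤ κ / 2)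
    (hu : 2 * u₁ ^ 2 * Real.log n ≤ δ * (n * h)) (hC₂ : C₂ * Real.log n / n ≤ ρ * h / 4)
    (hhx : h < 1 - x) (hθ₀ : 0 ≤ θ) (hθ : θ ≤ 1)
    (hC : ∀ u u' : Finset (Fin n), Disjoint u u' →
      Integrable (fun ε : Fin n → ℝ =>
        Real.exp (θ * (1 + s) / 2 * (noiseSq ε u + noiseSq ε u'))) (regNoise n) ∧
      ∫ ε, Real.exp (θ * (1 + s) / 2 * (noiseSq ε u + noiseSq ε u')) ∂regNoise n ≤ C)
    (hC' : ∀ u u' : Finset (Fin n), Disjoint u u' →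
      Integrable (fun ε : Fin n → ℝ =>
        Real.exp (1 / 2 / 2 * (noiseSq ε u + noiseSq ε u'))) (regNoise n) ∧
      ∫ ε, Real.exp (1 / 2 / 2 * (noiseSq ε u + noiseSq ε u')) ∂regNoise n ≤ C') :
    ∃ K : ℕ, K * (C₁ * Real.log n / n) ≤ 4 * h + C₁ * Real.log n / n ∧
      ∫ ε, partPost n N z xd B g (fun l => f (xd l) + ε l)
          (fun S _ => nIx n N xd z S x ≤ δ * (n * h)) ∂regNoise n ≤
        ((N : ℝ) + 1) ^ 2 * (Real.exp (-(4 * Real.log n)) * C') +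
          K ^ 2 * (((K : ℝ) + 1) *
            ((mergeConst c₀ c₁ τ * h ^ B * Real.exp (1 / 2 * (κ * Real.log n))) ^ θ * C)
            + 2 ^ B * moveConst c₀ c₁ τ * n * Real.exp (-(6 * Real.log n))) := by
  have hn0 : (0 : ℝ) < n := by exact_mod_cast hn
  have hd0 : 0 < C₁ * Real.log n / n := by positivity
  have hz : StrictMono z := strictMono_of_gap hd0 fun i => (hgrid.2.2 i).1
  have hρh : 0 < ρ * h := by positivity
  have hρh' : ρ * h ≤ 1 / 2 * h := by gcongr
  have hz01 : ∀ i, 0 ≤ z i ∧ z i ≤ 1 := fun i =>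
    ⟨hgrid.1 ▸ hz.monotone (Fin.zero_le i), hgrid.2.1 ▸ hz.monotone (Fin.le_last i)⟩
  have hdata : ∀ {j k : Knot N} {l}, l ∈ dataIn xd (z j) (z k) → z j < xd l ∧ xd l ≤ z k := by
    intro j k l hl
    simpa [dataIn] using hl
  have hdata01 : ∀ {j k : Knot N} {l}, l ∈ dataIn xd (z j) (z k) →
      xd l ∈ Set.Icc (0 : ℝ) 1 := by
    intro j k l hl
    exact ⟨(hz01 j).1.trans (hdata hl).1.le, (hdata hl).2.trans (hz01 k).2⟩
  have hs' : 0 < 1 + 1 / s := by positivity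
  set Q : Finset (Knot N × Knot N) := Finset.univ.filter fun q =>
    q.1 < q.2 ∧ x ∈ Set.Ioc (z q.1) (z q.2) ∧
      ((dataIn xd (z q.1) (z q.2)).card : ℝ) ≤ δ * (n * h) with hQdef
  set near : Knot N → Finset (Knot N) := fun j =>
    Finset.univ.filter fun k => j < k ∧ z k - z j ≤ ρ * h with hnear
  set G : Finset (Knot N) := Finset.univ.filter fun i => x - 2 * h ≤ z i ∧ z i ≤ x + 2 * h
    with hG
  have hm : ∀ j : Knot N, ∃ m, ∀ k, z j + ρ * h / 4 ≤ z k →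
      z j + ρ * h / 4 ≤ z m ∧ z m ≤ z j + ρ * h / 2 := by
    intro j
    by_cases hj : ∃ k, z j + ρ * h / 4 ≤ z k
    · obtain ⟨k, hk⟩ := hj
      obtain ⟨m, h1, h2⟩ := exists_knot_between hz (fun i => (hgrid.2.2 i).2)
        (by positivity) hk
      exact ⟨m, fun _ _ => ⟨h1, by linarith⟩⟩
    · exact ⟨j, fun k hk => absurd ⟨k, hk⟩ hj⟩
  choose m hm using hm
  have hQ : ∀ q ∈ Q, q.1 < q.2 ∧ x ∈ Set.Ioc (z q.1) (z q.2) ∧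
      ((dataIn xd (z q.1) (z q.2)).card : ℝ) ≤ δ * (n * h) := fun q hq => by
    simpa only [hQdef, Finset.mem_filter, Finset.mem_univ, true_and] using hq
  have hQlen : ∀ q ∈ Q, z q.2 - z q.1 ≤ ρ * h / 4 := by
    intro q hq
    obtain ⟨h1, h2, h3⟩ := hQ q hq
    have h4 := gap_le_of_card_le hΩ hz hu₁ hp₀ hn hpI hu (mem_IcalPairs_self h1 h2) h3
    have h5 : 8 * δ * h ≤ p₀ * ρ * h := by gcongr
    exact le_of_mul_le_mul_left (h4.trans (by linarith)) hp₀
  have hfI : ∀ q ∈ Q, ∀ l ∈ dataIn xd (z q.1) (z q.2), |f (xd l) - f x| ≤ M * e := by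
    intro q hq l hl
    have h1 := hQlen q hq
    obtain ⟨h2, h3⟩ := (hQ q hq).2.1
    obtain ⟨h4, h5⟩ := hdata hl
    exact hfx _ (hdata01 hl) (abs_le.2 ⟨by linarith, by linarith⟩)
  have hfJ : ∀ q ∈ Q, ∀ k, z k - z q.2 ≤ ρ * h → ∀ l ∈ dataIn xd (z q.2) (z k),
      |f (xd l) - f x| ≤ M * e := by
    intro q hq k hk l hl
    have h1 := hQlen q hq
    obtain ⟨h2, h3⟩ := (hQ q hq).2.1
    obtain ⟨h4, h5⟩ := hdata hl
    exact hfx _ (hdata01 hl) (abs_le.2 ⟨by linarith, by linarith⟩)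
  have hcI : ∀ q ∈ Q, ∀ v, 0 ≤ v → v ≤ M + D →
      (1 + 1 / s) * ((dataIn xd (z q.1) (z q.2)).card * (v * e) ^ 2) ≤ κ / 2 * Real.log n := by
    intro q hq v hv hv'
    have h1 := (hQ q hq).2.2
    calc (1 + 1 / s) * (((dataIn xd (z q.1) (z q.2)).card : ℝ) * (v * e) ^ 2)
        ≤ (1 + 1 / s) * (δ * (n * h) * ((M + D) * e) ^ 2) := by gcongr
      _ = (1 + 1 / s) * (δ * (M + D) ^ 2) * (n * h * e ^ 2) := by ring
      _ ≤ κ / 2 * Real.log n := by rw [hhe]; gcongr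
  have hD0 : 0 ≤ D := by
    have : 0 < 4 / μ := by positivity
    linarith
  have hκ0 : 0 ≤ κ := by
    have : 0 ≤ (1 + 1 / s) * (δ * (M + D) ^ 2) := by positivity
    linarith
  refine ⟨G.card, ?_, ?_⟩
  · have := card_mul_gap_le hd0.le (fun i => (hgrid.2.2 i).1)
      (show x - 2 * h ≤ x + 2 * h by linarith) (A := G) (fun i hi => by simpa [hG] using hi)
    linarith
  refine integral_partPost_le hz hg hc₀ hτ hB hn (c := f x) (h := h) (w := M) (e := e)
    (hf x ⟨hx.1.le, hx.2.le⟩) xd (fun l => f (xd l)) hs hκ hL hμ he hM hh.le hD hDe hθ₀ hθ hC hC'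
    (fun S => nIx n N xd z S x ≤ δ * (n * h)) Q near m ?_ ?_ ?_ ?_ ?_ ?_ ?_
  · intro S hS hA
    obtain ⟨i, j, hij, hxij⟩ := exists_consec_mem (z := z) hS (x := x)
      (by rw [hgrid.1, hgrid.2.1]; exact ⟨hx.1, hx.2.le⟩)
    rw [nIx_eq hz xd hij hxij] at hA
    have hqQ : (i, j) ∈ Q := by
      simp only [hQdef, Finset.mem_filter, Finset.mem_univ, true_and]
      exact ⟨hij.2.2.1, hxij, hA⟩
    refine ⟨(i, j), hqQ, hij, exists_consec_right hS.2 hij.2.1 ?_⟩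
    rintro rfl
    have h1 := hQlen _ hqQ
    simp only [hgrid.2.1] at h1
    linarith [hxij.1]
  · intro q hq
    refine ⟨(hQ q hq).1, ?_, hfI q hq, ?_⟩
    · linarith [hQlen q hq]
    · refine (hcI q hq (M + D) (by linarith) le_rfl).trans ?_
      nlinarith
  · exact fun j k l hl => hf _ (hdata01 hl)
  · intro q hq k hk hqk
    have hk' : z k - z q.2 ≤ ρ * h := by
      simp only [hnear, Finset.mem_filter, Finset.mem_univ, true_and] at hk
      exact hk.2
    refine ⟨hfJ q hq k hk', ?_⟩
    have h1 := hcI q hq M hM (by linarith)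
    have hmem := mem_IcalPairs_right (hQ q hq).1 hqk (hQ q hq).2.1
    obtain ⟨h2, h3⟩ := hpI (z q.2) (z k) (hz.monotone hqk.le)
    have h4 : 0 ≤ pI (z q.2) (z k) :=
      (mul_nonneg hp₀.le (sub_nonneg.2 (hz.monotone hqk.le))).trans h2
    have h5 := le_of_abs_sub_le hL.le (mul_nonneg hn0.le h4) (hΩ _ hmem)
    have h6 : pI (z q.2) (z k) ≤ p₁ * (ρ * h) := h3.trans (by
      have := hp₀.trans_le hp₀₁
      gcongr)
    have h7 : ((dataIn xd (z q.2) (z k)).card : ℝ) ≤ 2 * p₁ * ρ * (n * h) := by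
      have h8 : n * pI (z q.2) (z k) ≤ n * (p₁ * (ρ * h)) := by gcongr
      have h9 : δ * (n * h) ≤ p₁ * ρ * (n * h) := by
        have : p₀ * ρ ≤ p₁ * ρ := by gcongr
        have : δ ≤ p₁ * ρ := by linarith
        gcongr
      have h10 : ((nIv n xd (z q.2) (z k) : ℕ) : ℝ) = (dataIn xd (z q.2) (z k)).card := rfl
      linarith
    have h11 : (1 + 1 / s) * ((dataIn xd (z q.2) (z k)).card * (M * e) ^ 2) ≤
        κ / 2 * Real.log n := by
      calc (1 + 1 / s) * (((dataIn xd (z q.2) (z k)).card : ℝ) * (M * e) ^ 2)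
          ≤ (1 + 1 / s) * (2 * p₁ * ρ * (n * h) * (M * e) ^ 2) := by gcongr
        _ = (1 + 1 / s) * (2 * p₁ * ρ * M ^ 2) * (n * h * e ^ 2) := by ring
        _ ≤ κ / 2 * Real.log n := by rw [hhe]; gcongr
    linarith
  · intro q hq k hk hqk
    have hk' : ρ * h < z k - z q.2 := by
      simp only [hnear, Finset.mem_filter, Finset.mem_univ, true_and, not_and, not_le] at hk
      exact hk hqk
    obtain ⟨h1, h2⟩ := hm q.2 k (by linarith)
    have h3 : q.2 < m q.2 := hz.lt_iff_lt.1 (by linarith)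
    refine ⟨h3, hz.lt_iff_lt.1 (by linarith), by linarith,
      hfJ q hq _ (by linarith), ?_⟩
    have hmem := mem_IcalPairs_right (hQ q hq).1 h3 (hQ q hq).2.1
    obtain ⟨h4, -⟩ := hpI (z q.2) (z (m q.2)) (hz.monotone h3.le)
    have h5 : n * (p₀ * (ρ * h / 4)) ≤ n * pI (z q.2) (z (m q.2)) := by
      have : p₀ * (ρ * h / 4) ≤ p₀ * (z (m q.2) - z q.2) := by gcongr; linarith
      gcongr
      linarith
    have h6 : 8 * δ * (n * h) ≤ p₀ * ρ * (n * h) := by gcongr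
    have h7 := half_le_of_abs_sub_le hu₁.le (le_trans (by positivity) h5) (hΩ _ hmem)
      (by linarith)
    have h8 : p₀ * ρ / 8 * (n * h) ≤ (dataIn xd (z q.2) (z (m q.2))).card := by
      refine le_trans ?_ h7
      linarith
    rw [hμ', ← hhe]
    calc p₀ * ρ / 8 * (n * h * e ^ 2) = p₀ * ρ / 8 * (n * h) * e ^ 2 := by ring
      _ ≤ _ := by gcongr
  · have hsub : Q ⊆ G ×ˢ G := by
      intro q hq
      have h1 := hQlen q hq
      obtain ⟨h2, h3⟩ := (hQ q hq).2.1
      simp only [hG, Finset.mem_product, Finset.mem_filter, Finset.mem_univ, true_and]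
      refine ⟨⟨?_, ?_⟩, ?_, ?_⟩ <;> linarith
    calc Q.card ≤ (G ×ˢ G).card := Finset.card_le_card hsub
      _ = G.card ^ 2 := by rw [Finset.card_product, sq]
  · intro q hq
    refine Finset.card_le_card fun k hk => ?_
    have h1 := hQlen q hq
    obtain ⟨h2, h3⟩ := (hQ q hq).2.1
    simp only [hnear, Finset.mem_filter, Finset.mem_univ, true_and] at hk
    have h4 := hz hk.1
    simp only [hG, Finset.mem_filter, Finset.mem_univ, true_and]
    constructor <;> linarith

end Design

section Asymptotics

lemma exp_neg_mul_log {n : ℕ} (hn : 1 ≤ n) (k : ℕ) :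
    Real.exp (-(k * Real.log n)) = ((n : ℝ) ^ k)⁻¹ := by
  have hn0 : (0 : ℝ) < n := by exact_mod_cast hn
  rw [Real.exp_neg, Real.exp_nat_mul, Real.exp_log hn0]

lemma le_mul_bandwidth {n K : ℕ} {C₁ h : ℝ} (hn : 1 ≤ n) (hL : 1 ≤ Real.log n) (hC₁ : 0 < C₁)
    (hh : Real.log n / n ≤ h) (hK : K * (C₁ * Real.log n / n) ≤ 4 * h + C₁ * Real.log n / n) :
    (K : ℝ) + 1 ≤ (4 / C₁ + 2) * (h / (Real.log n / n)) := by
  have hn0 : (0 : ℝ) < n := by exact_mod_cast hn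
  have hr : 0 < Real.log n / n := by positivity
  set r := Real.log n / n
  rw [mul_div_assoc] at hK
  rw [← mul_div_assoc, le_div_iff₀ hr]
  have h1 : (K : ℝ) * r ≤ 4 / C₁ * h + r := by
    have h2 : C₁ * (K * r) ≤ C₁ * (4 / C₁ * h + r) := by
      have : C₁ * (4 / C₁ * h + r) = 4 * h + C₁ * r := by field_simp
      rw [this]
      linarith
    exact le_of_mul_le_mul_left h2 hC₁
  nlinarith

/-- The bound of `exists_integral_partPost_nIx_le` at `h = (log n / n)^{1/(2a+1)}` is `o(1/n)`. -/
lemma mul_bound_le {n N K : ℕ} {C₁ a h B θ κ σ c v C C' : ℝ} (hn : 1 ≤ n)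
    (hL : 1 ≤ Real.log n) (hC₁ : 0 < C₁) (ha : 0 < a) (ha1 : a ≤ 1)
    (hh : h = (Real.log n / n) ^ (1 / (2 * a + 1))) (hN : N * (C₁ * Real.log n / n) ≤ 1)
    (hK : K * (C₁ * Real.log n / n) ≤ 4 * h + C₁ * Real.log n / n)
    (hc : 0 ≤ c) (hv : 0 ≤ v) (hC : 0 ≤ C) (hC' : 0 ≤ C') (hθ : θ ≤ 1)
    (hκ₀ : 0 ≤ κ) (hκ : κ ≤ 2 * σ) (hBθ : B * θ = 9 + 6 * σ) :
    n * (((N : ℝ) + 1) ^ 2 * (Real.exp (-(4 * Real.log n)) * C') +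
        K ^ 2 * (((K : ℝ) + 1) * ((c * h ^ B * Real.exp (1 / 2 * (κ * Real.log n))) ^ θ * C)
          + 2 ^ B * v * n * Real.exp (-(6 * Real.log n)))) ≤
      ((1 / C₁ + 1) ^ 2 * C' + (4 / C₁ + 2) ^ 2 * (2 ^ B * v)) * (n : ℝ)⁻¹ +
        (4 / C₁ + 2) ^ 3 * (c ^ θ * C) *
          (Real.log n ^ (1 + 2 * σ) / (n : ℝ) ^ σ) := by
  have hn1 : (1 : ℝ) ≤ n := by exact_mod_cast hn
  have hn0 : (0 : ℝ) < n := by linarith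
  have hr : 0 < Real.log n / n := by positivity
  have hr1 : Real.log n / n ≤ 1 := by
    rw [div_le_one hn0]
    exact Real.log_le_self hn0.le
  have hσ : 0 ≤ σ := by linarith
  have ha2 : 0 < 2 * a + 1 := by linarith
  have hhr : Real.log n / n ≤ h := by
    rw [hh]
    conv_lhs => rw [← Real.rpow_one (Real.log n / n)]
    refine Real.rpow_le_rpow_of_exponent_ge hr hr1 ?_
    rw [div_le_one ha2]
    linarith
  have hh0 : 0 < h := hr.trans_le hhr
  have hh1 : h ≤ 1 := by
    rw [hh]
    exact Real.rpow_le_one hr.le hr1 (by positivity)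
  have hK1 := le_mul_bandwidth hn hL hC₁ hhr hK
  set A := 4 / C₁ + 2
  have hA : 0 < A := by positivity
  have hKn : (K : ℝ) ≤ A * n := by
    have : h / (Real.log n / n) ≤ n := by
      rw [div_le_iff₀ hr, mul_div_cancel₀ _ hn0.ne']
      linarith
    have : A * (h / (Real.log n / n)) ≤ A * n := by gcongr
    linarith
  have hN1 : (N : ℝ) + 1 ≤ (1 / C₁ + 1) * n := by
    have h1 : (N : ℝ) * C₁ ≤ n := by
      have h2 : (N : ℝ) * (C₁ * Real.log n / n) * n = N * C₁ * Real.log n := by field_simp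
      have h3 : (N : ℝ) * (C₁ * Real.log n / n) * n ≤ 1 * n := by gcongr
      have h4 : (N : ℝ) * C₁ * 1 ≤ N * C₁ * Real.log n := by gcongr
      linarith
    have h5 : (N : ℝ) ≤ n / C₁ := by rwa [le_div_iff₀ hC₁]
    have : (1 / C₁ + 1) * (n : ℝ) = n / C₁ + n := by ring
    linarith
  have e4 := exp_neg_mul_log hn 4
  have e6 := exp_neg_mul_log hn 6
  push_cast at e4 e6
  rw [e4, e6]
  have T1 : n * (((N : ℝ) + 1) ^ 2 * (((n : ℝ) ^ 4)⁻¹ * C')) ≤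
      (1 / C₁ + 1) ^ 2 * C' * (n : ℝ)⁻¹ := by
    calc n * (((N : ℝ) + 1) ^ 2 * (((n : ℝ) ^ 4)⁻¹ * C'))
        ≤ n * (((1 / C₁ + 1) * n) ^ 2 * (((n : ℝ) ^ 4)⁻¹ * C')) := by gcongr
      _ = _ := by field_simp
  have T3 : n * ((K : ℝ) ^ 2 * (2 ^ B * v * n * ((n : ℝ) ^ 6)⁻¹)) ≤
      A ^ 2 * (2 ^ B * v) * (n : ℝ)⁻¹ := by
    calc n * ((K : ℝ) ^ 2 * (2 ^ B * v * n * ((n : ℝ) ^ 6)⁻¹))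
        ≤ n * ((A * n) ^ 2 * (2 ^ B * v * n * ((n : ℝ) ^ 6)⁻¹)) := by gcongr
      _ = A ^ 2 * (2 ^ B * v) * ((n : ℝ) ^ 2)⁻¹ := by field_simp
      _ ≤ _ := by
        gcongr
        exact le_self_pow₀ hn1 (by norm_num)
  have hexp : (c * h ^ B * Real.exp (1 / 2 * (κ * Real.log n))) ^ θ ≤
      c ^ θ * h ^ (9 + 6 * σ) * (n : ℝ) ^ σ := by
    rw [Real.mul_rpow (by positivity) (Real.exp_pos _).le, Real.mul_rpow hc (by positivity),
      ← Real.rpow_mul hh0.le, hBθ, ← Real.exp_mul, Real.rpow_def_of_pos hn0]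
    refine mul_le_mul_of_nonneg_left (Real.exp_le_exp.2 ?_) (by positivity)
    have h1 : 0 ≤ Real.log n := by linarith
    nlinarith [mul_nonneg hκ₀ h1, mul_le_mul_of_nonneg_right hκ h1,
      mul_le_mul_of_nonneg_left hθ (mul_nonneg hκ₀ h1)]
  have hpow : (h / (Real.log n / n)) ^ 3 * h ^ (9 + 6 * σ) ≤
      (Real.log n / n) ^ (1 + 2 * σ) := by
    have h1 : (h / (Real.log n / n)) ^ 3 * h ^ (9 + 6 * σ) =
        (Real.log n / n) ^ ((12 + 6 * σ) / (2 * a + 1) - 3) := by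
      have h2 : h ^ 3 = (Real.log n / n) ^ (1 / (2 * a + 1) * 3) := by
        rw [hh, ← Real.rpow_natCast, ← Real.rpow_mul hr.le]
        norm_num
      have h3 : h ^ (9 + 6 * σ) = (Real.log n / n) ^ (1 / (2 * a + 1) * (9 + 6 * σ)) := by
        rw [hh, ← Real.rpow_mul hr.le]
      have h4 : (Real.log n / n) ^ 3 = (Real.log n / n) ^ (3 : ℝ) := by
        rw [← Real.rpow_natCast]
        norm_num
      rw [div_pow h, h2, h3, h4, ← Real.rpow_sub hr, ← Real.rpow_add hr]
      congr 1
      ring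
    rw [h1]
    refine Real.rpow_le_rpow_of_exponent_ge hr hr1 ?_
    rw [le_sub_iff_add_le, le_div_iff₀ ha2]
    nlinarith [mul_nonneg hσ (sub_nonneg.2 ha1)]
  have T2 : n * ((K : ℝ) ^ 2 * (((K : ℝ) + 1) *
      ((c * h ^ B * Real.exp (1 / 2 * (κ * Real.log n))) ^ θ * C))) ≤
      A ^ 3 * (c ^ θ * C) * (Real.log n ^ (1 + 2 * σ) / (n : ℝ) ^ σ) := by
    set w := h / (Real.log n / n)
    have hw : 0 < w := by positivity
    calc n * ((K : ℝ) ^ 2 * (((K : ℝ) + 1) *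
          ((c * h ^ B * Real.exp (1 / 2 * (κ * Real.log n))) ^ θ * C)))
        ≤ n * ((A * w) ^ 2 * ((A * w) * (c ^ θ * h ^ (9 + 6 * σ) * (n : ℝ) ^ σ * C))) := by
          gcongr
          linarith
      _ = A ^ 3 * (c ^ θ * C) * (w ^ 3 * h ^ (9 + 6 * σ)) * (n * (n : ℝ) ^ σ) := by ring
      _ ≤ A ^ 3 * (c ^ θ * C) * (Real.log n / n) ^ (1 + 2 * σ) * (n * (n : ℝ) ^ σ) := by
          gcongr
      _ = _ := by
          have h1 : (n : ℝ) ^ (1 + 2 * σ) = n * (n : ℝ) ^ σ * (n : ℝ) ^ σ := by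
            rw [Real.rpow_add hn0, Real.rpow_one, two_mul, Real.rpow_add hn0]
            ring
          rw [Real.div_rpow (by linarith) hn0.le, h1]
          field_simp
  linarith

lemma tendsto_log_div_natCast :
    Tendsto (fun n : ℕ => Real.log n / n) atTop (nhds 0) :=
  Real.isLittleO_log_id_atTop.tendsto_div_nhds_zero.comp tendsto_natCast_atTop_atTop

lemma tendsto_log_div_rpow {p : ℝ} (hp : 0 < p) :
    Tendsto (fun n : ℕ => (Real.log n / n) ^ p) atTop (nhds 0) := by
  simpa [Real.zero_rpow hp.ne'] using tendsto_log_div_natCast.rpow_const (Or.inr hp.le)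

lemma tendsto_bound {σ : ℝ} (hσ : 0 < σ) (c c' : ℝ) :
    Tendsto (fun n : ℕ => c * (n : ℝ)⁻¹ + c' * (Real.log n ^ (1 + 2 * σ) / (n : ℝ) ^ σ))
      atTop (nhds 0) := by
  have h1 : Tendsto (fun n : ℕ => (n : ℝ)⁻¹) atTop (nhds 0) := tendsto_inv_atTop_nhds_zero_nat
  have h2 : Tendsto (fun n : ℕ => Real.log n ^ (1 + 2 * σ) / (n : ℝ) ^ σ) atTop (nhds 0) :=
    (isLittleO_log_rpow_rpow_atTop (1 + 2 * σ) hσ).tendsto_div_nhds_zero.comp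
      tendsto_natCast_atTop_atTop
  simpa using (h1.const_mul c).add (h2.const_mul c')

lemma epsn_eq (t : ℝ → ℝ) (n : ℕ) (x : ℝ) :
    epsn t n x = (Real.log n / n) ^ (t x / (2 * t x + 1)) := by
  rw [epsn, neg_div, Real.rpow_neg (by positivity), ← Real.inv_rpow (by positivity), inv_div]

lemma mul_rpow_mul_rpow_sq {n : ℕ} {a : ℝ} (ha : 0 < a) (hL : 0 < Real.log n) :
    n * (Real.log n / n) ^ (1 / (2 * a + 1)) * ((Real.log n / n) ^ (a / (2 * a + 1))) ^ 2 =
      Real.log n := by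
  have hn0 : (0 : ℝ) < n := by
    rcases n.eq_zero_or_pos with rfl | h
    · simp at hL
    · exact_mod_cast h
  have hr : 0 < Real.log n / n := by positivity
  rw [← Real.rpow_natCast, ← Real.rpow_mul hr.le, mul_assoc, ← Real.rpow_add hr,
    show 1 / (2 * a + 1) + a / (2 * a + 1) * ((2 : ℕ) : ℝ) = 1 by push_cast; field_simp; ring,
    Real.rpow_one]
  field_simp

end Asymptotics

/-- Lemma 6.3: partitions whose cell containing x carries too few
observations have vanishing posterior mass: with δ > 0 small enough,
E[1_{Ω_{n,x}(u₁)} Π(S : n_{I_x^S} ≤ s_n(δ) | D_n)] = o(1/n). -/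
theorem statement19
    (t M η : ℝ → ℝ) (t₁ : ℝ) (hA1 : A1 t M η t₁)
    (x : ℝ) (hx : x ∈ Set.Ioo (0 : ℝ) 1)
    (B C₁ C₂ B₀ c₀ c₁ p₀ p₁ : ℝ)
    (hB : 9 < B) (hC₁ : 0 < C₁) (hC₁₂ : C₁ ≤ C₂)
    (hB₀ : 0 < B₀) (hc₀ : 0 < c₀) (hc₀₁ : c₀ ≤ c₁)
    (hp₀ : 0 < p₀) (hp₀₁ : p₀ ≤ p₁)
    (f₀ : ℝ → ℝ) (hf₀ : f₀ ∈ HolderClass t M η)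
    (hf₀B : ∃ b : ℝ, (∀ y ∈ Set.Icc (0 : ℝ) 1, |f₀ y| ≤ b) ∧ b < B₀)
    (Nf : ℕ → ℕ) (z : ∀ n : ℕ, Knot (Nf n) → ℝ) (xd : ∀ n : ℕ, Fin n → ℝ)
    (g : ∀ n : ℕ, Knot (Nf n) → ℝ → ℝ) (pI : ℕ → ℝ → ℝ → ℝ)
    (hgrid : ∀ n : ℕ, 2 ≤ n → IsGrid n (Nf n) (z n) C₁ C₂)
    (hdens : ∀ n : ℕ, GoodDens (Nf n) (g n) c₀ c₁ B₀)
    (hpI : ∀ n : ℕ, ∀ a b : ℝ, a ≤ b → p₀ * (b - a) ≤ pI n a b ∧ pI n a b ≤ p₁ * (b - a))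
    (u₁ : ℝ) (hu₁ : 0 < u₁) :
    ∃ δ₀ > (0 : ℝ), ∀ δ : ℝ, 0 < δ → δ ≤ δ₀ →
      Tendsto (fun n : ℕ =>
          (n : ℝ) *
            ((if OmegaX n (Nf n) (xd n) (z n) (pI n) u₁ x then (1 : ℝ) else 0) *
              ∫ ε, partPost n (Nf n) (z n) (xd n) B (g n) (fun i => f₀ (xd n i) + ε i)
                  (fun S _ => nIx n (Nf n) (xd n) (z n) S x ≤ snD t n x δ)
                ∂regNoise n))
        atTop (nhds 0) := by
  obtain ⟨b, hb, hbB⟩ := hf₀B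
  obtain ⟨hx0, hx1⟩ := hx
  have hxI : x ∈ Set.Icc (0 : ℝ) 1 := ⟨hx0.le, hx1.le⟩
  have ha : 0 < t x := hA1.ht₁.trans_le (hA1.t_lb x hxI)
  have ha1 := hA1.t_ub x hxI
  obtain ⟨Mmin, hMmin, hM⟩ := hA1.M_lb
  obtain ⟨emin, hemin, hη⟩ := hA1.eta_lb
  replace hM : 0 < M x := hMmin.trans_le (hM x hxI)
  replace hη : 0 < η x := hemin.trans_le (hη x hxI)
  set τ : ℝ := (B₀ - b) / 2 with hτ_def
  have hτ : 0 < τ := by linarith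
  set θ : ℝ := (B + 9) / 2 / B with hθ_def
  have hθ₀ : 0 < θ := by positivity
  have hθ : θ < 1 := by
    rw [hθ_def, div_lt_one (by linarith)]
    linarith
  set s : ℝ := (1 - θ) / 2 with hs_def
  have hs : 0 < s := by linarith
  set σ : ℝ := (B - 9) / 12 with hσ_def
  have hσ : 0 < σ := by linarith
  set κ : ℝ := min 1 (2 * σ) with hκ_def
  have hκ₀ : 0 < κ := lt_min one_pos (by linarith)
  have hp₁ : 0 < p₁ := hp₀.trans_le hp₀₁
  have hs' : 0 < 1 + 1 / s := by positivity
  set ρ : ℝ := min (1 / 2) (κ / 2 / ((1 + 1 / s) * (2 * p₁ * M x ^ 2))) with hρ_def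
  have hρ : 0 < ρ := lt_min (by norm_num) (by positivity)
  have hρκ : (1 + 1 / s) * (2 * p₁ * ρ * M x ^ 2) ≤ κ / 2 := by
    have h1 : ρ ≤ κ / 2 / ((1 + 1 / s) * (2 * p₁ * M x ^ 2)) := min_le_right _ _
    rw [le_div_iff₀ (by positivity)] at h1
    linarith
  set μ : ℝ := √(p₀ * ρ / 8) with hμ_def
  have hμ : 0 < μ := Real.sqrt_pos.2 (by positivity)
  have hμ' : μ ^ 2 = p₀ * ρ / 8 := Real.sq_sqrt (by positivity)
  set D : ℝ := 4 * (M x + 4 / μ) with hD_def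
  have hD : 0 < D := by positivity
  obtain ⟨C, hC, hCint⟩ := exists_integral_exp_noiseSq_le (κ := θ * (1 + s)) (by positivity)
    (by rw [hs_def]; nlinarith)
  obtain ⟨C', hC', hCint'⟩ := exists_integral_exp_noiseSq_le (κ := 1 / 2) (by norm_num)
    (by norm_num)
  refine ⟨min (p₀ * ρ / 8) (κ / 2 / ((1 + 1 / s) * (M x + D) ^ 2)),
    lt_min (by positivity) (by positivity), fun δ hδ hδ₀ => ?_⟩
  have hδρ : 8 * δ ≤ p₀ * ρ := by linarith [hδ₀.trans (min_le_left _ _)]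
  have hδκ : (1 + 1 / s) * (δ * (M x + D) ^ 2) ≤ κ / 2 := by
    have h1 := hδ₀.trans (min_le_right _ _)
    rw [le_div_iff₀ (by positivity)] at h1
    linarith
  have hlim_h := tendsto_log_div_rpow (p := 1 / (2 * t x + 1)) (by positivity)
  have hlim_e := tendsto_log_div_rpow (p := t x / (2 * t x + 1)) (by positivity)
  have hlim_e2 : Tendsto (fun n : ℕ => ((Real.log n / n) ^ (t x / (2 * t x + 1))) ^ 2)
      atTop (nhds 0) := by simpa using hlim_e.pow 2
  have hlogtop : Tendsto (fun n : ℕ => Real.log n) atTop atTop :=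
    Real.tendsto_log_atTop.comp tendsto_natCast_atTop_atTop
  refine squeeze_zero' ?_ ?_ (tendsto_bound hσ
    ((1 / C₁ + 1) ^ 2 * C' + (4 / C₁ + 2) ^ 2 * (2 ^ B * moveConst c₀ c₁ τ))
    ((4 / C₁ + 2) ^ 3 * (mergeConst c₀ c₁ τ ^ θ * C)))
  · filter_upwards [eventually_ge_atTop 2, hlogtop.eventually_ge_atTop 1] with n hn hL
    have hn0 : (0 : ℝ) < n := by positivity
    have hz : StrictMono (z n) := strictMono_of_gap
      (show 0 < C₁ * Real.log n / n by positivity) fun i => ((hgrid n hn).2.2 i).1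
    refine mul_nonneg hn0.le (mul_nonneg (by split_ifs <;> norm_num) (integral_nonneg fun ε => ?_))
    exact partPost_nonneg hz (hdens n) _ _ _
  have hsmall : ∀ {u : ℕ → ℝ} {v : ℝ}, Tendsto u atTop (nhds 0) → 0 < v →
      ∀ᶠ n in atTop, u n ≤ v := fun hu hv => (hu.eventually_lt_const hv).mono fun _ => le_of_lt
  filter_upwards [eventually_ge_atTop 2, hlogtop.eventually_ge_atTop 1,
    hlim_h.eventually_lt_const (sub_pos.2 hx1), hsmall hlim_h hη,
    hsmall (hlim_e.const_mul D |>.trans (by simp)) hτ,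
    hsmall (hlim_e2.const_mul (2 * u₁ ^ 2) |>.trans (by simp)) hδ,
    hsmall (hlim_e2.const_mul C₂ |>.trans (by simp)) (show 0 < ρ / 4 by positivity)]
    with n hn hL hhx hhη hDe hu hC₂
  set h : ℝ := (Real.log n / n) ^ (1 / (2 * t x + 1)) with hh_def
  set e : ℝ := (Real.log n / n) ^ (t x / (2 * t x + 1)) with he_def
  have hn1 : 1 ≤ n := by omega
  have hn0 : (0 : ℝ) < n := by positivity
  have hr : 0 < Real.log n / n := by positivity
  have hh : 0 < h := Real.rpow_pos_of_pos hr _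
  have he : 0 < e := Real.rpow_pos_of_pos hr _
  have hhe : n * h * e ^ 2 = Real.log n := mul_rpow_mul_rpow_sq ha (by linarith)
  have hd0 : 0 < C₁ * Real.log n / n := by positivity
  have hmc := mergeConst_nonneg (c₁ := c₁) hc₀ hτ
  have hmv := moveConst_nonneg (c₀ := c₀) (c₁ := c₁) (τ := τ)
  split_ifs with hΩ
  swap
  · rw [zero_mul, mul_zero]
    have : 0 ≤ Real.log n := by linarith
    positivity
  rw [one_mul]
  have hsn : snD t n x δ = δ * (n * h) := by
    rw [snD, epsn_eq, ← he_def, ← hhe]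
    field_simp
  rw [hsn]
  have hfx : ∀ y ∈ Set.Icc (0 : ℝ) 1, |y - x| ≤ h → |f₀ y - f₀ x| ≤ M x * e := by
    intro y hy hyx
    rcases eq_or_ne y x with rfl | hne
    · simpa using by positivity
    have h1 := (hf₀ x hxI).2 (y - x) (sub_ne_zero.2 hne) (hyx.trans hhη)
      (by rwa [add_sub_cancel])
    rw [add_sub_cancel] at h1
    have h2 : |y - x| ^ t x ≤ h ^ t x := by gcongr
    have h3 : h ^ t x = e := by
      rw [hh_def, he_def, ← Real.rpow_mul hr.le]
      congr 1
      ring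
    calc _ ≤ M x * |y - x| ^ t x := h1
      _ ≤ M x * e := by rw [← h3]; gcongr
  obtain ⟨K, hK, hint⟩ := exists_integral_partPost_nIx_le (hgrid n hn) hC₁ (hdens n) hc₀
    (B := B) (by linarith) hn1 (by linarith) ⟨hx0, hx1⟩ hu₁ hp₀ hp₀₁ (hpI n) hΩ (f := f₀) (τ := τ)
    (M := M x) (h := h) (e := e) (ρ := ρ) (δ := δ) (s := s) (κ := κ) (μ := μ) (D := D) (θ := θ)
    (fun y hy => (hb y hy).trans (by linarith)) hfx hτ hM.le hh he.le hhe hρ (min_le_left _ _) hμ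
    hμ' le_rfl hDe hδ hδρ hs (min_le_left _ _) hδκ hρκ
    (by rw [← hhe]
        calc 2 * u₁ ^ 2 * (n * h * e ^ 2) = 2 * u₁ ^ 2 * e ^ 2 * (n * h) := by ring
          _ ≤ δ * (n * h) := by gcongr)
    (by rw [← hhe]
        calc C₂ * (n * h * e ^ 2) / n = C₂ * e ^ 2 * h := by field_simp
          _ ≤ ρ / 4 * h := by gcongr
          _ = ρ * h / 4 := by ring)
    hhx hθ₀.le hθ.le (hCint n) (hCint' n)
  have hN : (Nf n : ℝ) * (C₁ * Real.log n / n) ≤ 1 := by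
    have h1 := grid_mul_sub_le (fun i => ((hgrid n hn).2.2 i).1) (Fin.zero_le (Fin.last (Nf n)))
    simpa [(hgrid n hn).1, (hgrid n hn).2.1] using h1
  refine (mul_le_mul_of_nonneg_left hint hn0.le).trans ?_
  exact mul_bound_le hn1 hL hC₁ ha ha1 hh_def hN hK hmc hmv hC.le hC'.le hθ.le hκ₀.le
    (min_le_right _ _) (by rw [hθ_def, hσ_def]; field_simp; ring)

end Spatial
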